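/- arXiv:2012.08445 — 5 statements merged into one kernel-verified Lean document; each statement's English description precedes it below -/
import Mathlib

section
/- Let d ≥ 1 and let t : (Fin d)⁴ → ℂ be a tensor such that the vectors |ĩ⟩ = d^{-1/2} ∑_{s1,s2,s3} t(i,s1,s2,s3) |s1⟩⊗|s2⟩⊗|s3⟩, for i ∈ Fin d, form an orthonormal family in (ℂ^d)⊗(ℂ^d)⊗(ℂ^d). Let ρ̃ = (1/d) ∑_i |ĩ⟩⟨ĩ|. Then I₃(P1:P2:P3)(ρ̃) = −2 log d if and only if all three d²×d² matrices t⁽¹⁾, t⁽²⁾, t⁽³⁾ are unitary (i.e. t is multi-unitary). -/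
open Matrix MeasureTheory ProbabilityTheory
open scoped ComplexOrder BigOperators

noncomputable section

/-- von Neumann entropy (natural logarithm), via the eigenvalues of a Hermitian matrix;
`Real.log 0 = 0` implements the convention `0 · log 0 = 0`. -/
def vN {n : Type*} [Fintype n] [DecidableEq n] (ρ : Matrix n n ℂ) : ℝ :=
  if h : ρ.IsHermitian then -∑ k, h.eigenvalues k * Real.log (h.eigenvalues k) else 0

/-- `ρ` is a density matrix: positive semidefinite with unit trace. -/
def IsDensity {n : Type*} [Fintype n] [DecidableEq n] (ρ : Matrix n n ℂ) : Prop :=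
  ρ.PosSemidef ∧ ρ.trace = 1

section reds
variable {α β γ : Type*} [Fintype α] [Fintype β] [Fintype γ]

/-- reduced density on party 1 (partial trace over parties 2, 3) -/
def red1 (ρ : Matrix (α × β × γ) (α × β × γ) ℂ) : Matrix α α ℂ :=
  Matrix.of fun a a' => ∑ b, ∑ c, ρ (a, b, c) (a', b, c)
/-- reduced density on party 2 -/
def red2 (ρ : Matrix (α × β × γ) (α × β × γ) ℂ) : Matrix β β ℂ :=
  Matrix.of fun b b' => ∑ a, ∑ c, ρ (a, b, c) (a, b', c)
/-- reduced density on party 3 -/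
def red3 (ρ : Matrix (α × β × γ) (α × β × γ) ℂ) : Matrix γ γ ℂ :=
  Matrix.of fun c c' => ∑ a, ∑ b, ρ (a, b, c) (a, b, c')
/-- reduced density on parties 1, 2 (partial trace over party 3) -/
def red12 (ρ : Matrix (α × β × γ) (α × β × γ) ℂ) : Matrix (α × β) (α × β) ℂ :=
  Matrix.of fun x y => ∑ c, ρ (x.1, x.2, c) (y.1, y.2, c)
/-- reduced density on parties 1, 3 -/
def red13 (ρ : Matrix (α × β × γ) (α × β × γ) ℂ) : Matrix (α × γ) (α × γ) ℂ :=
  Matrix.of fun x y => ∑ b, ρ (x.1, b, x.2) (y.1, b, y.2)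
/-- reduced density on parties 2, 3 -/
def red23 (ρ : Matrix (α × β × γ) (α × β × γ) ℂ) : Matrix (β × γ) (β × γ) ℂ :=
  Matrix.of fun x y => ∑ a, ρ (a, x.1, x.2) (a, y.1, y.2)

/-- tripartite information I₃(P1:P2:P3) -/
def I3 [DecidableEq α] [DecidableEq β] [DecidableEq γ]
    (ρ : Matrix (α × β × γ) (α × β × γ) ℂ) : ℝ :=
  vN (red1 ρ) + vN (red2 ρ) + vN (red3 ρ)
    - vN (red12 ρ) - vN (red13 ρ) - vN (red23 ρ) + vN ρ
end reds

/-- rank-one operator |v⟩⟨w| -/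
def outer {X : Type*} (v w : X → ℂ) : Matrix X X ℂ :=
  Matrix.of fun x y => v x * star (w y)

/-- orthonormal family of vectors -/
def ONFam {ι X : Type*} [DecidableEq ι] [Fintype X] (v : ι → X → ℂ) : Prop :=
  ∀ i j, (∑ x, star (v i x) * v j x) = if i = j then (1 : ℂ) else 0

/-- the support (range) of `ρ` is contained in the span of the family `v` -/
def SuppIn {ι X : Type*} [Fintype X] (ρ : Matrix X X ℂ) (v : ι → X → ℂ) : Prop :=
  LinearMap.range ρ.mulVecLin ≤ Submodule.span ℂ (Set.range v)

/-- a (rectangular) matrix is unitary -/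
def IsUnitaryM {A B : Type*} [Fintype A] [Fintype B] [DecidableEq A] [DecidableEq B]
    (U : Matrix A B ℂ) : Prop :=
  U * Uᴴ = 1 ∧ Uᴴ * U = 1

/-- operator norm (largest singular value) of a matrix -/
def opNorm {A B : Type*} [Fintype A] [Fintype B] [DecidableEq B]
    (M : Matrix A B ℂ) : ℝ :=
  ‖LinearMap.toContinuousLinearMap (Matrix.toEuclideanLin M)‖

/-- trace norm: the sum of the singular values -/
def traceNorm {A B : Type*} [Fintype A] [Fintype B] [DecidableEq B]
    (M : Matrix A B ℂ) : ℝ :=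
  ∑ k, Real.sqrt ((Matrix.posSemidef_conjTranspose_mul_self M).1.eigenvalues k)

/-- matrix logarithm taken on the support (eigenvalue `0 ↦ 0`, since `Real.log 0 = 0`) -/
def mlog {n : Type*} [Fintype n] [DecidableEq n] (ρ : Matrix n n ℂ) : Matrix n n ℂ :=
  if h : ρ.IsHermitian then
    (h.eigenvectorUnitary : Matrix n n ℂ) *
      Matrix.diagonal (fun k => (Real.log (h.eigenvalues k) : ℂ)) *
      (h.eigenvectorUnitary : Matrix n n ℂ)ᴴ
  else 0

/-- quantum relative entropy D(ρ‖σ) = Tr(ρ (log ρ − log σ)) -/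
def relEnt {n : Type*} [Fintype n] [DecidableEq n] (ρ σ : Matrix n n ℂ) : ℝ :=
  ((ρ * (mlog ρ - mlog σ)).trace).re

lemma vN_eq_sum_negMulLog {n : Type*} [Fintype n] [DecidableEq n] {ρ : Matrix n n ℂ}
    (h : ρ.IsHermitian) : vN ρ = ∑ k, Real.negMulLog (h.eigenvalues k) := by
  simp [vN, h, Real.negMulLog, Finset.sum_neg_distrib]

lemma IsDensity.sum_eigenvalues {n : Type*} [Fintype n] [DecidableEq n] {ρ : Matrix n n ℂ}
    (h : IsDensity ρ) : ∑ k, h.1.1.eigenvalues k = 1 := by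
  have := h.1.1.trace_eq_sum_eigenvalues.symm.trans h.2
  simp only [RCLike.ofReal_eq_complex_ofReal] at this
  exact_mod_cast this

/-- A density matrix which is proportional to a projection has flat spectrum. -/
lemma vN_eq_neg_log_of_mul_self {n : Type*} [Fintype n] [DecidableEq n] {ρ : Matrix n n ℂ}
    (h : IsDensity ρ) {c : ℝ} (hc : ρ * ρ = (c : ℂ) • ρ) : vN ρ = -Real.log c := by
  have hdiag := h.1.1.conjStarAlgAut_star_eigenvectorUnitary
  have hsq := congrArg (Unitary.conjStarAlgAut ℂ _ (star h.1.1.eigenvectorUnitary)) hc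
  rw [map_mul, map_smul, hdiag, diagonal_mul_diagonal, ← diagonal_smul] at hsq
  have hev : ∀ k, h.1.1.eigenvalues k * h.1.1.eigenvalues k = c * h.1.1.eigenvalues k := by
    intro k
    have := congrFun (diagonal_injective hsq) k
    simp only [Function.comp_apply, Pi.smul_apply, smul_eq_mul,
      RCLike.ofReal_eq_complex_ofReal] at this
    exact_mod_cast this
  have hterm : ∀ k, Real.negMulLog (h.1.1.eigenvalues k)
      = -(h.1.1.eigenvalues k * Real.log c) := by
    intro k
    by_cases h0 : h.1.1.eigenvalues k = 0
    · simp [h0]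
    · rw [mul_right_cancel₀ h0 (hev k)]
      simp [Real.negMulLog]
  rw [vN_eq_sum_negMulLog h.1.1, Finset.sum_congr rfl fun k _ => hterm k,
    Finset.sum_neg_distrib, ← Finset.sum_mul, h.sum_eigenvalues, one_mul]

/-- The tangent line bound for `negMulLog` at `r`. -/
lemma negMulLog_le_tangent {p r : ℝ} (hp : 0 ≤ p) (hr : 0 < r) :
    Real.negMulLog p ≤ -(p * Real.log r) + (r - p) := by
  have h := mul_le_mul_of_nonneg_left
    (Real.negMulLog_le_one_sub_self (div_nonneg hp hr.le)) hr.le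
  rcases hp.eq_or_lt with rfl | hp
  · simpa using hr.le
  · rw [Real.negMulLog, Real.log_div hp.ne' hr.ne'] at h
    rw [Real.negMulLog]
    field_simp at h
    linarith

lemma negMulLog_lt_tangent {p r : ℝ} (hp : 0 ≤ p) (hr : 0 < r) (hne : p ≠ r) :
    Real.negMulLog p < -(p * Real.log r) + (r - p) := by
  have h := mul_lt_mul_of_pos_left (Real.negMulLog_lt_one_sub_self (div_nonneg hp hr.le)
    (fun h => hne ((div_eq_one_iff_eq hr.ne').1 h))) hr
  rcases hp.eq_or_lt with rfl | hp
  · simpa using hr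
  · rw [Real.negMulLog, Real.log_div hp.ne' hr.ne'] at h
    rw [Real.negMulLog]
    field_simp at h
    linarith

section maximal
variable {n : Type*} [Fintype n] [DecidableEq n] [Nonempty n] {ρ : Matrix n n ℂ}

lemma sum_tangent_eigenvalues (h : IsDensity ρ) :
    ∑ k, (-(h.1.1.eigenvalues k * Real.log (Fintype.card n : ℝ)⁻¹)
      + ((Fintype.card n : ℝ)⁻¹ - h.1.1.eigenvalues k)) = Real.log (Fintype.card n) := by
  have hn : (Fintype.card n : ℝ) ≠ 0 := by exact_mod_cast Fintype.card_ne_zero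
  rw [Finset.sum_add_distrib, Finset.sum_sub_distrib, Finset.sum_neg_distrib, ← Finset.sum_mul,
    h.sum_eigenvalues]
  simp [hn]

/-- The von Neumann entropy is at most the logarithm of the dimension. -/
lemma vN_le_log_card (h : IsDensity ρ) : vN ρ ≤ Real.log (Fintype.card n) := by
  have hn : (0 : ℝ) < (Fintype.card n : ℝ)⁻¹ := by
    have := Fintype.card_pos (α := n)
    positivity
  rw [vN_eq_sum_negMulLog h.1.1, ← sum_tangent_eigenvalues h]
  exact Finset.sum_le_sum fun k _ => negMulLog_le_tangent (h.1.eigenvalues_nonneg k) hn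

/-- Only the maximally mixed state attains the maximal entropy. -/
lemma vN_eq_log_card_iff (h : IsDensity ρ) :
    vN ρ = Real.log (Fintype.card n) ↔ ρ = (Fintype.card n : ℂ)⁻¹ • (1 : Matrix n n ℂ) := by
  have hn : (0 : ℝ) < (Fintype.card n : ℝ)⁻¹ := by
    have := Fintype.card_pos (α := n)
    positivity
  constructor
  · intro he
    rw [vN_eq_sum_negMulLog h.1.1, ← sum_tangent_eigenvalues h,
      Finset.sum_eq_sum_iff_of_le fun k _ =>
        negMulLog_le_tangent (h.1.eigenvalues_nonneg k) hn] at he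
    have hev : ∀ k, h.1.1.eigenvalues k = (Fintype.card n : ℝ)⁻¹ := by
      intro k
      by_contra hk
      exact (negMulLog_lt_tangent (h.1.eigenvalues_nonneg k) hn hk).ne (he k (Finset.mem_univ k))
    have hD : diagonal (RCLike.ofReal ∘ h.1.1.eigenvalues)
        = (Fintype.card n : ℂ)⁻¹ • (1 : Matrix n n ℂ) := by
      rw [smul_one_eq_diagonal]
      congr 1
      funext k
      simp [hev k]
    rw [h.1.1.spectral_theorem, hD, map_smul, map_one]
  · intro he
    rw [vN_eq_neg_log_of_mul_self h (c := (Fintype.card n : ℝ)⁻¹), Real.log_inv, neg_neg]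
    rw [he]
    simp
end maximal

/-- Pinching to the diagonal in another orthonormal basis does not decrease entropy. -/
lemma vN_le_sum_negMulLog_diag {n : Type*} [Fintype n] [DecidableEq n] {ρ : Matrix n n ℂ}
    (h : ρ.PosSemidef) {W : Matrix n n ℂ} (hW : W ∈ unitaryGroup n ℂ) :
    vN ρ ≤ ∑ j, Real.negMulLog ((Wᴴ * ρ * W) j j).re := by
  set U : Matrix n n ℂ := h.1.eigenvectorUnitary.1
  have hUm : U ∈ unitaryGroup n ℂ := h.1.eigenvectorUnitary.2
  set V := Wᴴ * U with hVdef
  have hV : V ∈ unitaryGroup n ℂ := mul_mem (Unitary.star_mem hW) hUm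
  have hρ : Wᴴ * ρ * W = V * diagonal (fun k => (h.1.eigenvalues k : ℂ)) * Vᴴ := by
    have := h.1.spectral_theorem
    rw [Unitary.conjStarAlgAut_apply] at this
    conv_lhs => rw [this]
    rw [hVdef, conjTranspose_mul, conjTranspose_conjTranspose]
    simp only [Matrix.mul_assoc]
    rfl
  have hdiag : ∀ j, ((Wᴴ * ρ * W) j j).re
      = ∑ k, Complex.normSq (V j k) • h.1.eigenvalues k := by
    intro j
    have : (Wᴴ * ρ * W) j j
        = ((∑ k, Complex.normSq (V j k) • h.1.eigenvalues k : ℝ) : ℂ) := by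
      rw [hρ, mul_apply]
      push_cast
      refine Finset.sum_congr rfl fun k _ => ?_
      rw [mul_diagonal, conjTranspose_apply, smul_eq_mul]
      push_cast
      rw [← Complex.mul_conj]
      simp only [RCLike.star_def]
      ring
    rw [this, Complex.ofReal_re]
  have hrow : ∀ j, ∑ k, Complex.normSq (V j k) = 1 := by
    intro j
    have := congrFun (congrFun (mem_unitaryGroup_iff.1 hV) j) j
    rw [mul_apply, one_apply_eq] at this
    simp only [star_apply, RCLike.star_def, Complex.mul_conj] at this
    exact_mod_cast this
  have hcol : ∀ k, ∑ j, Complex.normSq (V j k) = 1 := by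
    intro k
    have := congrFun (congrFun (mem_unitaryGroup_iff'.1 hV) k) k
    rw [mul_apply, one_apply_eq] at this
    simp only [star_apply, RCLike.star_def, mul_comm, Complex.mul_conj] at this
    exact_mod_cast this
  calc vN ρ = ∑ k, ∑ j, Complex.normSq (V j k) • Real.negMulLog (h.1.eigenvalues k) := by
        rw [vN_eq_sum_negMulLog h.1]
        refine Finset.sum_congr rfl fun k _ => ?_
        rw [← Finset.sum_smul, hcol, one_smul]
    _ = ∑ j, ∑ k, Complex.normSq (V j k) • Real.negMulLog (h.1.eigenvalues k) :=
        Finset.sum_comm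
    _ ≤ _ := by
        refine Finset.sum_le_sum fun j _ => ?_
        rw [hdiag]
        exact Real.concaveOn_negMulLog.le_map_sum (fun k _ => Complex.normSq_nonneg _) (hrow j)
          fun k _ => h.eigenvalues_nonneg k

/-- Subadditivity of the Shannon entropy. -/
lemma sum_negMulLog_le_add {α β : Type*} [Fintype α] [Fintype β] {P : α → β → ℝ}
    (hP : ∀ a b, 0 ≤ P a b) (h1 : ∑ a, ∑ b, P a b = 1) :
    ∑ a, ∑ b, Real.negMulLog (P a b)
      ≤ ∑ a, Real.negMulLog (∑ b, P a b) + ∑ b, Real.negMulLog (∑ a, P a b) := by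
  set q : α → ℝ := fun a => ∑ b, P a b
  set r : β → ℝ := fun b => ∑ a, P a b
  have hq0 : ∀ a, 0 ≤ q a := fun a => Finset.sum_nonneg fun b _ => hP a b
  have hr0 : ∀ b, 0 ≤ r b := fun b => Finset.sum_nonneg fun a _ => hP a b
  have hPq : ∀ a b, P a b ≤ q a := fun a b =>
    Finset.single_le_sum (fun b _ => hP a b) (Finset.mem_univ b)
  have hPr : ∀ a b, P a b ≤ r b := fun a b =>
    Finset.single_le_sum (f := fun a => P a b) (fun a _ => hP a b) (Finset.mem_univ a)
  have hr1 : ∑ b, r b = 1 := by rw [← h1, Finset.sum_comm]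
  have hterm : ∀ a b, Real.negMulLog (P a b)
      ≤ -(P a b * Real.log (q a)) + -(P a b * Real.log (r b)) + (q a * r b - P a b) := by
    intro a b
    rcases (hP a b).eq_or_lt with h | h
    · simpa [← h] using mul_nonneg (hq0 a) (hr0 b)
    · have hq := h.trans_le (hPq a b)
      have hr := h.trans_le (hPr a b)
      have := negMulLog_le_tangent (hP a b) (mul_pos hq hr)
      rw [Real.log_mul hq.ne' hr.ne'] at this
      linarith
  have hA : ∑ a, ∑ b, -(P a b * Real.log (q a)) = ∑ a, Real.negMulLog (q a) := by
    refine Finset.sum_congr rfl fun a _ => ?_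
    rw [Finset.sum_neg_distrib, ← Finset.sum_mul, Real.negMulLog, neg_mul]
  have hB : ∑ a, ∑ b, -(P a b * Real.log (r b)) = ∑ b, Real.negMulLog (r b) := by
    rw [Finset.sum_comm]
    refine Finset.sum_congr rfl fun b _ => ?_
    rw [Finset.sum_neg_distrib, ← Finset.sum_mul, Real.negMulLog, neg_mul]
  have hC : ∑ a, ∑ b, (q a * r b - P a b) = 0 := by
    simp only [Finset.sum_sub_distrib]
    rw [← Finset.sum_mul_sum, h1, hr1]
    simp
  refine (Finset.sum_le_sum fun a _ => Finset.sum_le_sum fun b _ => hterm a b).trans_eq ?_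
  simp only [Finset.sum_add_distrib]
  rw [hA, hB, hC, add_zero]

section bipartite
variable {α β : Type*}

/-- partial trace over the second tensor factor -/
def traceRight [Fintype β] (M : Matrix (α × β) (α × β) ℂ) : Matrix α α ℂ :=
  Matrix.of fun a a' => ∑ b, M (a, b) (a', b)

/-- partial trace over the first tensor factor -/
def traceLeft [Fintype α] (M : Matrix (α × β) (α × β) ℂ) : Matrix β β ℂ :=
  Matrix.of fun b b' => ∑ a, M (a, b) (a, b')

lemma traceLeft_eq_traceRight_swap [Fintype α] (M : Matrix (α × β) (α × β) ℂ) :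
    traceLeft M = traceRight (M.submatrix Prod.swap Prod.swap) := rfl

variable [Fintype α] [Fintype β] [DecidableEq α] [DecidableEq β] {M : Matrix (α × β) (α × β) ℂ}

lemma IsDensity.traceRight (h : IsDensity M) : IsDensity (traceRight M) := by
  constructor
  · have : _root_.traceRight M = ∑ b, M.submatrix (fun a => (a, b)) (fun a => (a, b)) := by
      ext a a'
      simp [_root_.traceRight, Matrix.sum_apply]
    rw [this]
    exact posSemidef_sum _ fun b _ => h.1.submatrix _
  · rw [← h.2]
    simp [_root_.traceRight, trace, Fintype.sum_prod_type]

lemma IsDensity.swap (h : IsDensity M) :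
    IsDensity (M.submatrix (Prod.swap : β × α → α × β) Prod.swap) := by
  refine ⟨h.1.submatrix _, ?_⟩
  rw [← h.2]
  exact (Equiv.prodComm β α).sum_comp fun x => M x x

lemma IsDensity.traceLeft (h : IsDensity M) : IsDensity (traceLeft M) :=
  h.swap.traceRight

open scoped Kronecker

/-- A local unitary on the traced-out factor drops out of the partial trace. -/
lemma traceRight_conj_kronecker {α : Type*} [Fintype α] {M : Matrix (α × β) (α × β) ℂ}
    (A : Matrix α α ℂ) {B : Matrix β β ℂ}
    (hB : B ∈ unitaryGroup β ℂ) :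
    traceRight ((A ⊗ₖ B)ᴴ * M * (A ⊗ₖ B)) = Aᴴ * traceRight M * A := by
  have hB' : ∀ y x, ∑ b, B y b * star (B x b) = if y = x then 1 else 0 := by
    intro y x
    have := congrFun (congrFun (mem_unitaryGroup_iff.1 hB) y) x
    rwa [mul_apply, one_apply] at this
  ext a a'
  calc ∑ b, ((A ⊗ₖ B)ᴴ * M * (A ⊗ₖ B)) (a, b) (a', b)
      = ∑ b, ∑ y : α × β, ∑ x : α × β,
          star (A x.1 a) * M x y * A y.1 a' * (B y.2 b * star (B x.2 b)) := by
        refine Finset.sum_congr rfl fun b _ => ?_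
        rw [mul_apply]
        refine Finset.sum_congr rfl fun y _ => ?_
        rw [mul_apply, Finset.sum_mul]
        refine Finset.sum_congr rfl fun x _ => ?_
        simp only [conjTranspose_apply, kroneckerMap_apply, star_mul']
        ring
    _ = ∑ y : α × β, ∑ x : α × β,
          star (A x.1 a) * M x y * A y.1 a' * ∑ b, B y.2 b * star (B x.2 b) := by
        rw [Finset.sum_comm]
        refine Finset.sum_congr rfl fun y _ => ?_
        rw [Finset.sum_comm]
        simp only [Finset.mul_sum]
    _ = ∑ y₁, ∑ y₂, ∑ x₁, star (A x₁ a) * M (x₁, y₂) (y₁, y₂) * A y₁ a' := by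
        simp only [hB', Fintype.sum_prod_type]
        simp
    _ = (Aᴴ * traceRight M * A) a a' := by
        rw [mul_apply]
        refine Finset.sum_congr rfl fun y₁ _ => ?_
        rw [mul_apply, Finset.sum_mul, Finset.sum_comm]
        refine Finset.sum_congr rfl fun x₁ _ => ?_
        simp only [conjTranspose_apply, traceRight, of_apply, Finset.mul_sum, Finset.sum_mul]

lemma traceLeft_conj_kronecker {β : Type*} [Fintype β] {M : Matrix (α × β) (α × β) ℂ}
    {A : Matrix α α ℂ} (B : Matrix β β ℂ)
    (hA : A ∈ unitaryGroup α ℂ) :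
    traceLeft ((A ⊗ₖ B)ᴴ * M * (A ⊗ₖ B)) = Bᴴ * traceLeft M * B := by
  have hswap : (A ⊗ₖ B).submatrix (Prod.swap : β × α → α × β) Prod.swap = B ⊗ₖ A := by
    ext x y
    simp [mul_comm]
  rw [traceLeft_eq_traceRight_swap, traceLeft_eq_traceRight_swap,
    ← traceRight_conj_kronecker B hA, ← hswap, conjTranspose_submatrix]
  congr 1
  have e : (Prod.swap : β × α → α × β) = Equiv.prodComm β α := rfl
  rw [e, submatrix_mul_equiv, submatrix_mul_equiv]

/-- Subadditivity of the von Neumann entropy. -/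
lemma vN_le_traceRight_add_traceLeft (h : IsDensity M) :
    vN M ≤ vN (traceRight M) + vN (traceLeft M) := by
  have hR := h.traceRight.1.1
  have hL := h.traceLeft.1.1
  set A : Matrix α α ℂ := hR.eigenvectorUnitary.1
  set B : Matrix β β ℂ := hL.eigenvectorUnitary.1
  have hA : A ∈ unitaryGroup α ℂ := hR.eigenvectorUnitary.2
  have hB : B ∈ unitaryGroup β ℂ := hL.eigenvectorUnitary.2
  have hW : A ⊗ₖ B ∈ unitaryGroup (α × β) ℂ := kronecker_mem_unitary hA hB
  set N := (A ⊗ₖ B)ᴴ * M * (A ⊗ₖ B)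
  have hN : N.PosSemidef := h.1.conjTranspose_mul_mul_same _
  have hNR : ∀ a, ∑ b, (N (a, b) (a, b)).re = hR.eigenvalues a := by
    intro a
    have h1 : traceRight N = diagonal (RCLike.ofReal ∘ hR.eigenvalues) := by
      rw [traceRight_conj_kronecker A hB, ← hR.conjStarAlgAut_star_eigenvectorUnitary,
        Unitary.conjStarAlgAut_star_apply]
      rfl
    have h2 := congrArg Complex.re (congrFun (congrFun h1 a) a)
    simpa [traceRight] using h2
  have hNL : ∀ b, ∑ a, (N (a, b) (a, b)).re = hL.eigenvalues b := by
    intro b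
    have h1 : traceLeft N = diagonal (RCLike.ofReal ∘ hL.eigenvalues) := by
      rw [traceLeft_conj_kronecker B hA, ← hL.conjStarAlgAut_star_eigenvectorUnitary,
        Unitary.conjStarAlgAut_star_apply]
      rfl
    have h2 := congrArg Complex.re (congrFun (congrFun h1 b) b)
    simpa [traceLeft] using h2
  refine (vN_le_sum_negMulLog_diag h.1 hW).trans ?_
  rw [Fintype.sum_prod_type]
  refine (sum_negMulLog_le_add (P := fun a b => (N (a, b) (a, b)).re)
    (fun a b => (Complex.le_def.1 (hN.diag_nonneg (i := (a, b)))).1) ?_).trans_eq ?_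
  · simp only [hNR]
    exact h.traceRight.sum_eigenvalues
  · simp only [hNR, hNL]
    rw [vN_eq_sum_negMulLog hR, vN_eq_sum_negMulLog hL]
end bipartite

section reductions
variable {α β γ : Type*}

lemma red1_eq_traceRight_red12 [Fintype β] [Fintype γ] (ρ : Matrix (α × β × γ) (α × β × γ) ℂ) :
    red1 ρ = traceRight (red12 ρ) := rfl

lemma red1_eq_traceRight_red13 [Fintype β] [Fintype γ] (ρ : Matrix (α × β × γ) (α × β × γ) ℂ) :
    red1 ρ = traceRight (red13 ρ) := by
  ext
  exact Finset.sum_comm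

lemma red2_eq_traceLeft_red12 [Fintype α] [Fintype γ] (ρ : Matrix (α × β × γ) (α × β × γ) ℂ) :
    red2 ρ = traceLeft (red12 ρ) := rfl

lemma red2_eq_traceRight_red23 [Fintype α] [Fintype γ] (ρ : Matrix (α × β × γ) (α × β × γ) ℂ) :
    red2 ρ = traceRight (red23 ρ) := by
  ext
  exact Finset.sum_comm

lemma red3_eq_traceLeft_red13 [Fintype α] [Fintype β] (ρ : Matrix (α × β × γ) (α × β × γ) ℂ) :
    red3 ρ = traceLeft (red13 ρ) := rfl

lemma red3_eq_traceLeft_red23 [Fintype α] [Fintype β] (ρ : Matrix (α × β × γ) (α × β × γ) ℂ) :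
    red3 ρ = traceLeft (red23 ρ) := by
  ext
  exact Finset.sum_comm

end reductions

section tripartite
variable {α β γ : Type*} [Fintype α] [Fintype β] [Fintype γ]
  [DecidableEq α] [DecidableEq β] [DecidableEq γ]
  {ρ : Matrix (α × β × γ) (α × β × γ) ℂ}

lemma IsDensity.red23 (h : IsDensity ρ) : IsDensity (red23 ρ) := h.traceLeft

lemma IsDensity.red12 (h : IsDensity ρ) : IsDensity (red12 ρ) := by
  have h' : IsDensity (ρ.submatrix (Equiv.prodAssoc α β γ) (Equiv.prodAssoc α β γ)) :=
    ⟨h.1.submatrix _, h.2 ▸ (Equiv.prodAssoc α β γ).sum_comp fun x => ρ x x⟩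
  exact h'.traceRight

lemma IsDensity.red13 (h : IsDensity ρ) : IsDensity (red13 ρ) := by
  let e : (α × γ) × β ≃ α × β × γ :=
    (Equiv.prodAssoc α γ β).trans ((Equiv.refl α).prodCongr (Equiv.prodComm γ β))
  have h' : IsDensity (ρ.submatrix e e) := ⟨h.1.submatrix _, h.2 ▸ e.sum_comp fun x => ρ x x⟩
  exact h'.traceRight

end tripartite

/-- A tripartite state with entropy `log d` has minimal tripartite information exactly when all
its two-party reductions are maximally mixed. -/
lemma I3_eq_neg_two_mul_log_iff {d : ℕ} (hd : 1 ≤ d)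
    {ρ : Matrix (Fin d × Fin d × Fin d) (Fin d × Fin d × Fin d) ℂ} (h : IsDensity ρ)
    (hS : vN ρ = Real.log d) :
    I3 ρ = -2 * Real.log d ↔
      red23 ρ = ((d : ℂ) * d)⁻¹ • 1 ∧ red13 ρ = ((d : ℂ) * d)⁻¹ • 1 ∧
        red12 ρ = ((d : ℂ) * d)⁻¹ • 1 := by
  have : NeZero d := ⟨by omega⟩
  have hlog : Real.log (Fintype.card (Fin d × Fin d)) = 2 * Real.log d := by
    have : (d : ℝ) ≠ 0 := NeZero.ne _
    simp [Real.log_mul this this, two_mul]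
  have hmax : ∀ {σ : Matrix (Fin d × Fin d) (Fin d × Fin d) ℂ}, IsDensity σ →
      (σ = ((d : ℂ) * d)⁻¹ • 1 ↔ vN σ = 2 * Real.log d) := by
    intro σ hσ
    rw [← hlog, vN_eq_log_card_iff hσ]
    simp
  have u1 := vN_le_log_card h.red12.traceRight
  have u2 := vN_le_log_card h.red12.traceLeft
  have u3 := vN_le_log_card h.red13.traceLeft
  have u12 := vN_le_log_card h.red12
  have u13 := vN_le_log_card h.red13
  have u23 := vN_le_log_card h.red23
  have s12 := vN_le_traceRight_add_traceLeft h.red12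
  have s13 := vN_le_traceRight_add_traceLeft h.red13
  have s23 := vN_le_traceRight_add_traceLeft h.red23
  rw [hlog] at u12 u13 u23
  rw [Fintype.card_fin] at u1 u2 u3
  rw [← red1_eq_traceRight_red12] at u1
  rw [← red2_eq_traceLeft_red12] at u2
  rw [← red3_eq_traceLeft_red13] at u3
  rw [← red1_eq_traceRight_red12, ← red2_eq_traceLeft_red12] at s12
  rw [← red1_eq_traceRight_red13, ← red3_eq_traceLeft_red13] at s13
  rw [← red2_eq_traceRight_red23, ← red3_eq_traceLeft_red23] at s23
  rw [hmax h.red23, hmax h.red13, hmax h.red12, I3, hS]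
  constructor
  · intro he
    refine ⟨?_, ?_, ?_⟩ <;> linarith
  · rintro ⟨h23, h13, h12⟩
    linarith

lemma isUnitaryM_iff {n : Type*} [Fintype n] [DecidableEq n] {U : Matrix n n ℂ} :
    IsUnitaryM U ↔ U * Uᴴ = 1 :=
  ⟨fun h => h.1, fun h => ⟨h, mul_eq_one_comm.1 h⟩⟩

/-- The uniform mixture of an orthonormal family is a density matrix with flat spectrum. -/
lemma isDensity_and_vN_uniform_mixture {X : Type*} [Fintype X] [DecidableEq X] {d : ℕ}
    (hd : 1 ≤ d) {v : Fin d → X → ℂ} (hon : ONFam v) :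
    IsDensity ((d : ℂ)⁻¹ • ∑ i, outer (v i) (v i)) ∧
      vN ((d : ℂ)⁻¹ • ∑ i, outer (v i) (v i)) = Real.log d := by
  have hd0 : (d : ℂ) ≠ 0 := by exact_mod_cast (by omega : d ≠ 0)
  set A : Matrix X (Fin d) ℂ := Matrix.of fun x i => v i x
  have hA : Aᴴ * A = 1 := by
    ext i j
    rw [mul_apply, one_apply]
    exact hon i j
  have hout : ∑ i, outer (v i) (v i) = A * Aᴴ := by
    ext x y
    simp [outer, Matrix.sum_apply, mul_apply, A]
  rw [hout]
  have hdens : IsDensity ((d : ℂ)⁻¹ • (A * Aᴴ)) := by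
    refine ⟨(posSemidef_self_mul_conjTranspose A).smul ?_, ?_⟩
    · rw [← Complex.ofReal_natCast, ← Complex.ofReal_inv]
      exact Complex.zero_le_real.2 (by positivity)
    · rw [trace_smul, trace_mul_comm, hA]
      simp [hd0]
  refine ⟨hdens, ?_⟩
  rw [vN_eq_neg_log_of_mul_self hdens (c := (d : ℝ)⁻¹), Real.log_inv, neg_neg]
  have : A * Aᴴ * (A * Aᴴ) = A * Aᴴ := by
    rw [Matrix.mul_assoc, ← Matrix.mul_assoc Aᴴ, hA, Matrix.one_mul]
  rw [smul_mul_smul_comm, this, smul_smul]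
  simp

/-- minimality of tripartite information `I₃ = −2 log d` for the maximally mixed
density on the code space is equivalent to multi-unitarity of the tensor `t`. -/
theorem stmt0 (d : ℕ) (hd : 1 ≤ d)
    (t : Fin d → Fin d → Fin d → Fin d → ℂ)
    (v : Fin d → (Fin d × Fin d × Fin d) → ℂ)
    (hv : ∀ i x, v i x = (Real.sqrt d : ℂ)⁻¹ * t i x.1 x.2.1 x.2.2)
    (hon : ONFam v)
    (ρ : Matrix (Fin d × Fin d × Fin d) (Fin d × Fin d × Fin d) ℂ)
    (hρ : ρ = (d : ℂ)⁻¹ • ∑ i, outer (v i) (v i)) :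
    I3 ρ = -2 * Real.log d ↔
      (IsUnitaryM (Matrix.of fun p q : Fin d × Fin d => t q.1 q.2 p.1 p.2) ∧
       IsUnitaryM (Matrix.of fun p q : Fin d × Fin d => t q.1 p.1 q.2 p.2) ∧
       IsUnitaryM (Matrix.of fun p q : Fin d × Fin d => t q.1 p.1 p.2 q.2)) := by
  have hmix := isDensity_and_vN_uniform_mixture hd hon
  rw [← hρ] at hmix
  obtain ⟨hdens, hS⟩ := hmix
  have hd0 : (d : ℂ) ≠ 0 := by exact_mod_cast (by omega : d ≠ 0)
  have hc : ((d : ℂ) * d)⁻¹ ≠ 0 := inv_ne_zero (mul_ne_zero hd0 hd0)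
  have hentry : ∀ x y, ρ x y =
      ((d : ℂ) * d)⁻¹ * ∑ i, t i x.1 x.2.1 x.2.2 * star (t i y.1 y.2.1 y.2.2) := by
    intro x y
    have hsq : (Real.sqrt d : ℂ)⁻¹ * (Real.sqrt d : ℂ)⁻¹ = (d : ℂ)⁻¹ := by
      rw [← mul_inv, ← Complex.ofReal_mul, Real.mul_self_sqrt (Nat.cast_nonneg d),
        Complex.ofReal_natCast]
    rw [hρ, Matrix.smul_apply, Matrix.sum_apply, smul_eq_mul, Finset.mul_sum, Finset.mul_sum]
    refine Finset.sum_congr rfl fun i _ => ?_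
    simp only [outer, of_apply, hv, star_mul', mul_inv, ← hsq]
    simp only [star_inv₀, RCLike.star_def, Complex.conj_ofReal]
    ring
  rw [I3_eq_neg_two_mul_log_iff hd hdens hS, isUnitaryM_iff, isUnitaryM_iff, isUnitaryM_iff]
  have h23 : red23 ρ = ((d : ℂ) * d)⁻¹ •
      ((Matrix.of fun p q : Fin d × Fin d => t q.1 q.2 p.1 p.2) *
        (Matrix.of fun p q : Fin d × Fin d => t q.1 q.2 p.1 p.2)ᴴ) := by
    ext x y
    simp only [red23, of_apply, hentry, Matrix.smul_apply, mul_apply, conjTranspose_apply,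
      Fintype.sum_prod_type, smul_eq_mul, ← Finset.mul_sum]
    rw [Finset.sum_comm]
  have h13 : red13 ρ = ((d : ℂ) * d)⁻¹ •
      ((Matrix.of fun p q : Fin d × Fin d => t q.1 p.1 q.2 p.2) *
        (Matrix.of fun p q : Fin d × Fin d => t q.1 p.1 q.2 p.2)ᴴ) := by
    ext x y
    simp only [red13, of_apply, hentry, Matrix.smul_apply, mul_apply, conjTranspose_apply,
      Fintype.sum_prod_type, smul_eq_mul, ← Finset.mul_sum]
    rw [Finset.sum_comm]
  have h12 : red12 ρ = ((d : ℂ) * d)⁻¹ •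
      ((Matrix.of fun p q : Fin d × Fin d => t q.1 p.1 p.2 q.2) *
        (Matrix.of fun p q : Fin d × Fin d => t q.1 p.1 p.2 q.2)ᴴ) := by
    ext x y
    simp only [red12, of_apply, hentry, Matrix.smul_apply, mul_apply, conjTranspose_apply,
      Fintype.sum_prod_type, smul_eq_mul, ← Finset.mul_sum]
    rw [Finset.sum_comm]
  rw [h23, h13, h12, (smul_right_injective _ hc).eq_iff, (smul_right_injective _ hc).eq_iff,
    (smul_right_injective _ hc).eq_iff]
end
end

section
/- Let {|ĩ⟩}_{i=1}^r be an orthonormal family in ℂ^{d1}⊗ℂ^{d2}⊗ℂ^{d3}, let a ∈ {1,2,3} and let {b,c} = {1,2,3}∖{a}. Assume the recovery condition holds for party P_a, with unitary U_a and unit vector |χ_a⟩. Then for every density matrix ρ̃ whose support is contained in span{|ĩ⟩}, the reduced density Tr_{P_bP_c} ρ̃ equals the partial trace of |χ_a⟩⟨χ_a| over its first ℂ^{d_a} factor; in particular Tr_{P_bP_c} ρ̃ does not depend on the choice of ρ̃. -/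
open Matrix MeasureTheory ProbabilityTheory
open scoped ComplexOrder BigOperators

noncomputable section

/-- A Hermitian matrix supported in the span of an orthonormal family, whose vectors are the columns
of the isometry `V`, has the form `V C Vᴴ`. -/
theorem SuppIn.exists_eq_mul_mul_conjTranspose {ι X : Type*} [Fintype ι] [DecidableEq ι] [Fintype X]
    {v : ι → X → ℂ} (hv : ONFam v) {ρ : Matrix X X ℂ} (hρ : ρ.IsHermitian) (hs : SuppIn ρ v)
    {V : Matrix X ι ℂ} (hV : V = Matrix.of fun x i => v i x) :
    Vᴴ * V = 1 ∧ ∃ C : Matrix ι ι ℂ, ρ = V * C * Vᴴ := by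
  classical
  have hVV : Vᴴ * V = 1 := by
    ext i j
    simpa [hV, Matrix.mul_apply, Matrix.one_apply] using hv i j
  have hcol (y : X) : ∃ c : ι → ℂ, ∀ x, ρ x y = ∑ i, c i * v i x := by
    have hy : ρ.mulVecLin (Pi.single y 1) ∈ Submodule.span ℂ (Set.range v) :=
      hs (LinearMap.mem_range_self _ _)
    obtain ⟨c, hc⟩ := (Submodule.mem_span_range_iff_exists_fun ℂ).1 hy
    refine ⟨c, fun x => ?_⟩
    simpa using (congrFun hc x).symm
  choose c hc using hcol
  have hfac : ρ = V * Matrix.of fun i y => c y i := by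
    ext x y
    simp [hV, Matrix.mul_apply, hc, mul_comm]
  have hleft : V * Vᴴ * ρ = ρ := by
    rw [hfac, Matrix.mul_assoc, ← Matrix.mul_assoc Vᴴ, hVV, Matrix.one_mul]
  have hright : ρ * (V * Vᴴ) = ρ := by
    simpa [Matrix.conjTranspose_mul, hρ.eq] using congrArg Matrix.conjTranspose hleft
  refine ⟨hVV, Vᴴ * ρ * V, ?_⟩
  calc
    ρ = V * Vᴴ * ρ * (V * Vᴴ) := by rw [hleft, hright]
    _ = V * (Vᴴ * ρ * V) * Vᴴ := by simp only [Matrix.mul_assoc]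

/-- Under the recovery condition for the party `A`, the reduced density on `A` of any density
matrix supported in the code space is the partial trace of `|χ⟩⟨χ|` over its first factor. -/
theorem sum_eq_of_recovery {ι X A B : Type*} [Fintype ι] [DecidableEq ι] [Fintype X]
    [DecidableEq X] [Fintype A] [DecidableEq A] [Fintype B] [DecidableEq B]
    (e : A → B → X) {v : ι → X → ℂ} (hv : ONFam v)
    {U : Matrix B (ι × A) ℂ} {χ : A × A → ℂ} (hU : IsUnitaryM U)
    (hrec : ∀ i a b, v i (e a b) = ∑ s, U b (i, s) * χ (s, a))
    {ρ : Matrix X X ℂ} (hρ : IsDensity ρ) (hs : SuppIn ρ v) (q q' : A) :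
    ∑ b, ρ (e q b) (e q' b) = ∑ p, χ (p, q) * star (χ (p, q')) := by
  obtain ⟨hVV, C, hcomp⟩ :=
    SuppIn.exists_eq_mul_mul_conjTranspose hv hρ.1.isHermitian hs rfl
  set V : Matrix X ι ℂ := Matrix.of fun x i => v i x with hV
  have htr : C.trace = 1 := by
    rw [← hρ.2, congrArg Matrix.trace hcomp, Matrix.trace_mul_comm, ← Matrix.mul_assoc, hVV,
      Matrix.one_mul]
  let N (a : A) : Matrix (ι × A) ι ℂ := Matrix.of fun x j => if x.1 = j then χ (x.2, a) else 0
  have hsub (a : A) : V.submatrix (e a) id = U * N a := by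
    ext b i
    simp [hV, N, hrec, Matrix.mul_apply, Fintype.sum_prod_type_right]
  have hN : (N q')ᴴ * N q = (∑ p, χ (p, q) * star (χ (p, q'))) • (1 : Matrix ι ι ℂ) := by
    ext i j
    by_cases hij : i = j <;>
      simp [N, Matrix.mul_apply, Fintype.sum_prod_type_right, hij, eq_comm, mul_comm, apply_ite]
  have hgram : (U * N q')ᴴ * (U * N q) =
      (∑ p, χ (p, q) * star (χ (p, q'))) • (1 : Matrix ι ι ℂ) := by
    rw [Matrix.conjTranspose_mul, Matrix.mul_assoc, ← Matrix.mul_assoc Uᴴ, hU.2,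
      Matrix.one_mul, hN]
  calc
    ∑ b, ρ (e q b) (e q' b) = (ρ.submatrix (e q) (e q')).trace := rfl
    _ = (U * N q * C * (U * N q')ᴴ).trace := by
      rw [← hsub, ← hsub]
      exact congrArg (fun M : Matrix X X ℂ => (M.submatrix (e q) (e q')).trace) hcomp
    _ = ∑ p, χ (p, q) * star (χ (p, q')) := by
      rw [Matrix.mul_assoc, Matrix.trace_mul_comm, Matrix.mul_assoc, hgram]
      simp [htr]

/-- if the recovery condition holds for party `P_a` (a ∈ {1,2,3}, here `a : Fin 3`),
with unitary `U_a` and unit vector `χ_a`, then for every density matrix supported in the span of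
the code basis, the reduced density on `P_a` equals the partial trace of `|χ_a⟩⟨χ_a|` over the
first factor; in particular it is independent of the density matrix. -/
theorem stmt1 (d1 d2 d3 r : ℕ)
    (v : Fin r → (Fin d1 × Fin d2 × Fin d3) → ℂ) (hon : ONFam v) (a : Fin 3) :
    ![ -- a = 0 : party P₁ is erased, {b,c} = {2,3}
      (∀ (U : Matrix (Fin d2 × Fin d3) (Fin r × Fin d1) ℂ) (χ : Fin d1 × Fin d1 → ℂ),
        IsUnitaryM U → (∑ x, star (χ x) * χ x) = 1 →
        (∀ i s1 s2 s3, v i (s1, s2, s3) = ∑ s', U (s2, s3) (i, s') * χ (s', s1)) →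
        ∀ ρ : Matrix (Fin d1 × Fin d2 × Fin d3) (Fin d1 × Fin d2 × Fin d3) ℂ,
          IsDensity ρ → SuppIn ρ v →
          red1 ρ = Matrix.of fun q q' => ∑ p, χ (p, q) * star (χ (p, q'))),
      -- a = 1 : party P₂ is erased, {b,c} = {1,3}
      (∀ (U : Matrix (Fin d1 × Fin d3) (Fin r × Fin d2) ℂ) (χ : Fin d2 × Fin d2 → ℂ),
        IsUnitaryM U → (∑ x, star (χ x) * χ x) = 1 →
        (∀ i s1 s2 s3, v i (s1, s2, s3) = ∑ s', U (s1, s3) (i, s') * χ (s', s2)) →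
        ∀ ρ : Matrix (Fin d1 × Fin d2 × Fin d3) (Fin d1 × Fin d2 × Fin d3) ℂ,
          IsDensity ρ → SuppIn ρ v →
          red2 ρ = Matrix.of fun q q' => ∑ p, χ (p, q) * star (χ (p, q'))),
      -- a = 2 : party P₃ is erased, {b,c} = {1,2}
      (∀ (U : Matrix (Fin d1 × Fin d2) (Fin r × Fin d3) ℂ) (χ : Fin d3 × Fin d3 → ℂ),
        IsUnitaryM U → (∑ x, star (χ x) * χ x) = 1 →
        (∀ i s1 s2 s3, v i (s1, s2, s3) = ∑ s', U (s1, s2) (i, s') * χ (s', s3)) →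
        ∀ ρ : Matrix (Fin d1 × Fin d2 × Fin d3) (Fin d1 × Fin d2 × Fin d3) ℂ,
          IsDensity ρ → SuppIn ρ v →
          red3 ρ = Matrix.of fun q q' => ∑ p, χ (p, q) * star (χ (p, q')))] a := by
  fin_cases a
  · intro U χ hU _ hrec ρ hρ hs
    ext q q'
    simpa [red1, Fintype.sum_prod_type] using
      sum_eq_of_recovery (fun s (t : Fin d2 × Fin d3) => (s, t.1, t.2)) hon hU
        (fun i s t => hrec i s t.1 t.2) hρ hs q q'
  · intro U χ hU _ hrec ρ hρ hs
    ext q q'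
    simpa [red2, Fintype.sum_prod_type] using
      sum_eq_of_recovery (fun s (t : Fin d1 × Fin d3) => (t.1, s, t.2)) hon hU
        (fun i s t => hrec i t.1 s t.2) hρ hs q q'
  · intro U χ hU _ hrec ρ hρ hs
    ext q q'
    simpa [red3, Fintype.sum_prod_type] using
      sum_eq_of_recovery (fun s (t : Fin d1 × Fin d2) => (t.1, t.2, s)) hon hU
        (fun i s t => hrec i t.1 t.2 s) hρ hs q q'
end
end

section
/- Let {|ĩ⟩}_{i=1}^r be an orthonormal family in ℂ^{d1}⊗ℂ^{d2}⊗ℂ^{d3}, let a ∈ {1,2,3} and {b,c} = {1,2,3}∖{a}, and assume the recovery condition holds for party P_a. Then for every density matrix ρ̃ supported in span{|ĩ⟩}, the entropies satisfy S(Tr_{P_a} ρ̃) = S(ρ̃) + S(Tr_{P_bP_c} ρ̃), i.e. S(P_bP_c) = S(R) + S(P_a). -/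
open Matrix MeasureTheory ProbabilityTheory
open scoped ComplexOrder BigOperators

noncomputable section

/-- the recovery condition for party `P₁`: there are a unitary
`U : ℂ^r ⊗ ℂ^{d1} → ℂ^{d2} ⊗ ℂ^{d3}` and a unit vector `χ ∈ ℂ^{d1} ⊗ ℂ^{d1}` with
`|ĩ⟩ = (1_{P₁} ⊗ U)(|i⟩ ⊗ |χ⟩)` for all `i`. -/
def Rec1 {d1 d2 d3 r : ℕ} (v : Fin r → (Fin d1 × Fin d2 × Fin d3) → ℂ) : Prop :=
  ∃ (U : Matrix (Fin d2 × Fin d3) (Fin r × Fin d1) ℂ) (χ : Fin d1 × Fin d1 → ℂ),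
    IsUnitaryM U ∧ (∑ x, star (χ x) * χ x) = 1 ∧
    ∀ i s1 s2 s3, v i (s1, s2, s3) = ∑ s', U (s2, s3) (i, s') * χ (s', s1)

/-- the recovery condition for party `P₂` -/
def Rec2 {d1 d2 d3 r : ℕ} (v : Fin r → (Fin d1 × Fin d2 × Fin d3) → ℂ) : Prop :=
  ∃ (U : Matrix (Fin d1 × Fin d3) (Fin r × Fin d2) ℂ) (χ : Fin d2 × Fin d2 → ℂ),
    IsUnitaryM U ∧ (∑ x, star (χ x) * χ x) = 1 ∧
    ∀ i s1 s2 s3, v i (s1, s2, s3) = ∑ s', U (s1, s3) (i, s') * χ (s', s2)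

/-- the recovery condition for party `P₃` -/
def Rec3 {d1 d2 d3 r : ℕ} (v : Fin r → (Fin d1 × Fin d2 × Fin d3) → ℂ) : Prop :=
  ∃ (U : Matrix (Fin d1 × Fin d2) (Fin r × Fin d3) ℂ) (χ : Fin d3 × Fin d3 → ℂ),
    IsUnitaryM U ∧ (∑ x, star (χ x) * χ x) = 1 ∧
    ∀ i s1 s2 s3, v i (s1, s2, s3) = ∑ s', U (s1, s2) (i, s') * χ (s', s3)

/-- Entropy of a Hermitian matrix in terms of the roots of its characteristic polynomial. -/
theorem vN_eq_sum_roots_charpoly {n : Type*} [Fintype n] [DecidableEq n] {M : Matrix n n ℂ}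
    (h : M.IsHermitian) :
    vN M = (M.charpoly.roots.map fun z => Real.negMulLog z.re).sum := by
  rw [vN, dif_pos h, h.roots_charpoly_eq_eigenvalues, Multiset.map_map, ← Finset.sum_neg_distrib]
  simp [Real.negMulLog]

/-- The nonzero spectra of `A * B` and `B * A` agree, hence so do the entropies. -/
theorem vN_mul_comm {m n : Type*} [Fintype m] [DecidableEq m] [Fintype n] [DecidableEq n]
    {A : Matrix m n ℂ} {B : Matrix n m ℂ} (hAB : (A * B).IsHermitian)
    (hBA : (B * A).IsHermitian) : vN (A * B) = vN (B * A) := by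
  have h := congrArg (fun p => (p.roots.map fun z : ℂ => Real.negMulLog z.re).sum)
    (Matrix.charpoly_mul_comm' A B)
  beta_reduce at h
  rw [Polynomial.roots_mul (mul_ne_zero (pow_ne_zero _ Polynomial.X_ne_zero)
      (Matrix.charpoly_monic _).ne_zero),
    Polynomial.roots_mul (mul_ne_zero (pow_ne_zero _ Polynomial.X_ne_zero)
      (Matrix.charpoly_monic _).ne_zero)] at h
  rw [vN_eq_sum_roots_charpoly hAB, vN_eq_sum_roots_charpoly hBA]
  simpa [Polynomial.roots_X_pow, Multiset.map_nsmul, Multiset.sum_nsmul] using h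

theorem vN_transpose {n : Type*} [Fintype n] [DecidableEq n] {M : Matrix n n ℂ}
    (h : M.IsHermitian) : vN Mᵀ = vN M := by
  rw [vN_eq_sum_roots_charpoly h, vN_eq_sum_roots_charpoly h.transpose, Matrix.charpoly_transpose]

theorem vN_diagonal {n : Type*} [Fintype n] [DecidableEq n] (d : n → ℝ) :
    vN (Matrix.diagonal fun i => (d i : ℂ)) = ∑ i, Real.negMulLog (d i) := by
  have h : (Matrix.diagonal fun i => (d i : ℂ)).IsHermitian := by
    rw [Matrix.isHermitian_diagonal_iff]
    intro i
    simp [isSelfAdjoint_iff]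
  rw [vN_eq_sum_roots_charpoly h, Matrix.charpoly_diagonal,
    Polynomial.roots_prod _ _ (Finset.prod_ne_zero_iff.2 fun i _ => Polynomial.X_sub_C_ne_zero _)]
  simp

/-- Entropy is invariant under conjugation by an isometry. -/
theorem vN_isometry_conj {m n : Type*} [Fintype m] [DecidableEq m] [Fintype n] [DecidableEq n]
    {W : Matrix m n ℂ} (hW : Wᴴ * W = 1) {M : Matrix n n ℂ} (hM : M.IsHermitian) :
    vN (W * M * Wᴴ) = vN M := by
  have hc : M * Wᴴ * W = M := by rw [Matrix.mul_assoc, hW, Matrix.mul_one]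
  have h := vN_mul_comm (A := W) (B := M * Wᴴ)
    (by rw [← Matrix.mul_assoc]; exact Matrix.isHermitian_mul_mul_conjTranspose W hM)
    (by rw [hc]; exact hM)
  rwa [hc, ← Matrix.mul_assoc] at h

open scoped Kronecker in
/-- Entropy is additive on tensor products of trace-one Hermitian matrices. -/
theorem vN_kronecker {m n : Type*} [Fintype m] [DecidableEq m] [Fintype n] [DecidableEq n]
    {A : Matrix m m ℂ} {B : Matrix n n ℂ} (hA : A.IsHermitian) (hB : B.IsHermitian)
    (tA : A.trace = 1) (tB : B.trace = 1) : vN (A ⊗ₖ B) = vN A + vN B := by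
  set P : Matrix m m ℂ := hA.eigenvectorUnitary.1
  set Q : Matrix n n ℂ := hB.eigenvectorUnitary.1
  have hP : Pᴴ * P = 1 := Unitary.coe_star_mul_self hA.eigenvectorUnitary
  have hQ : Qᴴ * Q = 1 := Unitary.coe_star_mul_self hB.eigenvectorUnitary
  have eA : A = P * Matrix.diagonal (fun i => (hA.eigenvalues i : ℂ)) * Pᴴ :=
    hA.spectral_theorem
  have eB : B = Q * Matrix.diagonal (fun i => (hB.eigenvalues i : ℂ)) * Qᴴ :=
    hB.spectral_theorem
  have sA : ∑ i, hA.eigenvalues i = 1 := by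
    simpa [tA] using (congrArg Complex.re hA.trace_eq_sum_eigenvalues).symm
  have sB : ∑ i, hB.eigenvalues i = 1 := by
    simpa [tB] using (congrArg Complex.re hB.trace_eq_sum_eigenvalues).symm
  have hK : A ⊗ₖ B = (P ⊗ₖ Q) *
      Matrix.diagonal (fun x : m × n => ((hA.eigenvalues x.1 * hB.eigenvalues x.2 : ℝ) : ℂ)) *
      (P ⊗ₖ Q)ᴴ := by
    conv_lhs => rw [eA, eB]
    rw [Matrix.mul_kronecker_mul, Matrix.mul_kronecker_mul, Matrix.conjTranspose_kronecker,
      Matrix.diagonal_kronecker_diagonal]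
    simp
  have hD : (Matrix.diagonal (fun x : m × n =>
      ((hA.eigenvalues x.1 * hB.eigenvalues x.2 : ℝ) : ℂ))).IsHermitian := by
    rw [Matrix.isHermitian_diagonal_iff]
    intro i
    simp [isSelfAdjoint_iff]
  rw [hK, vN_isometry_conj _ hD, vN_diagonal, Fintype.sum_prod_type]
  · simp only [Real.negMulLog_mul, Finset.sum_add_distrib, ← Finset.sum_mul, ← Finset.mul_sum,
      sA, sB, one_mul]
    rw [vN, dif_pos hA, vN, dif_pos hB, ← Finset.sum_neg_distrib, ← Finset.sum_neg_distrib]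
    simp [Real.negMulLog]
  · rw [Matrix.conjTranspose_kronecker, ← Matrix.mul_kronecker_mul, hP, hQ,
      Matrix.one_kronecker_one]

/-- A Hermitian matrix supported in the span of an orthonormal family is the conjugate, by the
isometry with these columns, of its compression. -/
theorem SuppIn.eq_conj_compression {ι X : Type*} [Fintype ι] [DecidableEq ι] [Fintype X]
    {ρ : Matrix X X ℂ} {v : ι → X → ℂ} {V : Matrix X ι ℂ} (hV : ∀ x i, V x i = v i x)
    (hVV : Vᴴ * V = 1) (hρ : ρ.IsHermitian) (hs : SuppIn ρ v) :
    ρ = V * (Vᴴ * ρ * V) * Vᴴ := by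
  classical
  have hfix : ∀ w ∈ Submodule.span ℂ (Set.range v), (V * Vᴴ).mulVec w = w := by
    intro w hw
    induction hw using Submodule.span_induction with
    | mem w hw =>
      obtain ⟨i, rfl⟩ := hw
      have hc : v i = V.mulVec (Pi.single i 1) := by
        ext x
        simp [hV]
      rw [hc, Matrix.mulVec_mulVec, Matrix.mul_assoc, hVV, Matrix.mul_one]
    | zero => simp
    | add _ _ _ _ h₁ h₂ => rw [Matrix.mulVec_add, h₁, h₂]
    | smul c _ _ h => rw [Matrix.mulVec_smul, h]
  have hl : V * Vᴴ * ρ = ρ := by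
    refine Matrix.ext_of_mulVec_single fun i => ?_
    rw [← Matrix.mulVec_mulVec]
    exact hfix _ (hs ⟨_, rfl⟩)
  have hr : ρ * (V * Vᴴ) = ρ := by
    have := congrArg Matrix.conjTranspose hl
    simpa [Matrix.conjTranspose_mul, hρ.eq] using this
  calc ρ = V * Vᴴ * ρ * (V * Vᴴ) := by rw [hl, hr]
    _ = _ := by simp only [Matrix.mul_assoc]

open scoped Kronecker in
/-- Entropy identity for a code on `α × B` whose codewords are `(1 ⊗ U)(|i⟩ ⊗ |χ⟩)`. -/
theorem vN_traceout_eq_add {α B ι X : Type*} [Fintype α] [DecidableEq α] [Fintype B]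
    [DecidableEq B] [Fintype ι] [DecidableEq ι] [Fintype X] [DecidableEq X]
    (e : α × B ≃ X) (v : ι → X → ℂ) (hon : ONFam v) (U : Matrix B (ι × α) ℂ)
    (χ : α × α → ℂ) (hU : IsUnitaryM U) (hχ : (∑ x, star (χ x) * χ x) = 1)
    (hv : ∀ i s t, v i (e (s, t)) = ∑ s', U t (i, s') * χ (s', s))
    (ρ : Matrix X X ℂ) (hρ : IsDensity ρ) (hs : SuppIn ρ v) :
    vN (Matrix.of fun t t' => ∑ s, ρ (e (s, t)) (e (s, t'))) =
      vN ρ + vN (Matrix.of fun s s' => ∑ t, ρ (e (s, t)) (e (s', t))) := by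
  set V : Matrix X ι ℂ := Matrix.of fun x i => v i x with hVdef
  have hVV : Vᴴ * V = 1 := by
    ext i j
    simpa [Matrix.mul_apply, Matrix.one_apply, hVdef] using hon i j
  set σ : Matrix ι ι ℂ := Vᴴ * ρ * V
  have hσ : σ.IsHermitian := Matrix.isHermitian_conjTranspose_mul_mul V hρ.1.1
  have hρσ : ρ = V * σ * Vᴴ := hs.eq_conj_compression (fun _ _ => rfl) hVV hρ.1.1
  have hσt : σ.trace = 1 := by
    have := congrArg Matrix.trace hρσ
    rwa [Matrix.trace_mul_comm, ← Matrix.mul_assoc, hVV, Matrix.one_mul, hρ.2, eq_comm] at this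
  set c : Matrix α α ℂ := Matrix.of fun a s => χ (a, s) with hc
  set C : α → Matrix (ι × α) ι ℂ := fun s => Matrix.of fun x j => if x.1 = j then c x.2 s else 0
    with hC
  have hVC : ∀ s, V.submatrix (fun t => e (s, t)) id = U * C s := by
    intro s
    ext t i
    simp [Matrix.mul_apply, hVdef, hv, hC, hc, Fintype.sum_prod_type_right]
  have hCe : ∀ s s' x y, (C s * σ * (C s')ᴴ) x y = c x.2 s * σ x.1 y.1 * star (c y.2 s') := by
    intro s s' x y
    simp [Matrix.mul_apply, hC, apply_ite]
  have hblock : ∀ s s' t t', ρ (e (s, t)) (e (s', t')) = (U * (C s * σ * (C s')ᴴ) * Uᴴ) t t' := by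
    intro s s' t t'
    have : U * (C s * σ * (C s')ᴴ) * Uᴴ = (U * C s) * σ * (U * C s')ᴴ := by
      simp only [Matrix.conjTranspose_mul, Matrix.mul_assoc]
    rw [this, ← hVC, ← hVC, hρσ]
    simp [Matrix.mul_apply]
  have hB : (Matrix.of fun t t' => ∑ s, ρ (e (s, t)) (e (s, t'))) = U * (σ ⊗ₖ (c * cᴴ)) * Uᴴ := by
    have hsum : σ ⊗ₖ (c * cᴴ) = ∑ s, C s * σ * (C s)ᴴ := by
      ext x y
      simp only [Matrix.sum_apply, hCe, Matrix.kroneckerMap_apply, Matrix.mul_apply,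
        Matrix.conjTranspose_apply, Finset.mul_sum]
      exact Finset.sum_congr rfl fun _ _ => by ring
    ext t t'
    rw [hsum, Matrix.mul_sum, Matrix.sum_mul, Matrix.sum_apply]
    simp [hblock]
  have hA : (Matrix.of fun s s' => ∑ t, ρ (e (s, t)) (e (s', t))) = (cᴴ * c)ᵀ := by
    ext s s'
    have : ∑ t, ρ (e (s, t)) (e (s', t)) = (C s * σ * (C s')ᴴ).trace := by
      simp only [hblock]
      change Matrix.trace (U * (C s * σ * (C s')ᴴ) * Uᴴ) = _
      rw [Matrix.trace_mul_comm, ← Matrix.mul_assoc, hU.2, Matrix.one_mul]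
    simp only [Matrix.of_apply, this, Matrix.trace, Matrix.diag, hCe, Fintype.sum_prod_type_right,
      ← Finset.sum_mul, ← Finset.mul_sum]
    have ht : ∑ i, σ i i = 1 := hσt
    simp [ht, Matrix.mul_apply, mul_comm]
  have hct : (c * cᴴ).trace = 1 := by
    rw [← hχ]
    simp [Matrix.trace, Matrix.mul_apply, hc, Fintype.sum_prod_type, mul_comm]
  have hcc : (c * cᴴ).IsHermitian := Matrix.isHermitian_mul_conjTranspose_self c
  have hcc' : (cᴴ * c).IsHermitian := Matrix.isHermitian_conjTranspose_mul_self c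
  have hK : (σ ⊗ₖ (c * cᴴ)).IsHermitian := by
    rw [Matrix.IsHermitian, Matrix.conjTranspose_kronecker, hσ.eq, hcc.eq]
  have hvρ : vN ρ = vN σ := by
    rw [hρσ, vN_isometry_conj hVV hσ]
  rw [hB, hA, vN_isometry_conj hU.2 hK, vN_kronecker hσ hcc hσt hct, hvρ, vN_transpose hcc',
    vN_mul_comm hcc hcc']

/-- under the recovery condition for party `P_a`, every density matrix supported
in the code space satisfies `S(Tr_{P_a} ρ̃) = S(ρ̃) + S(Tr_{P_bP_c} ρ̃)`. -/
theorem stmt2 (d1 d2 d3 r : ℕ)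
    (v : Fin r → (Fin d1 × Fin d2 × Fin d3) → ℂ) (hon : ONFam v) (a : Fin 3)
    (hrec : ![Rec1 v, Rec2 v, Rec3 v] a)
    (ρ : Matrix (Fin d1 × Fin d2 × Fin d3) (Fin d1 × Fin d2 × Fin d3) ℂ)
    (hρ : IsDensity ρ) (hsupp : SuppIn ρ v) :
    ![ vN (red23 ρ) = vN ρ + vN (red1 ρ),
       vN (red13 ρ) = vN ρ + vN (red2 ρ),
       vN (red12 ρ) = vN ρ + vN (red3 ρ)] a := by
  fin_cases a
  · obtain ⟨U, χ, hU, hχ, hv⟩ := hrec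
    have h := vN_traceout_eq_add (Equiv.refl _) v hon U χ hU hχ
      (fun i s t => hv i s t.1 t.2) ρ hρ hsupp
    simp only [Fintype.sum_prod_type] at h
    exact h
  · obtain ⟨U, χ, hU, hχ, hv⟩ := hrec
    let e : Fin d2 × (Fin d1 × Fin d3) ≃ Fin d1 × Fin d2 × Fin d3 :=
      ⟨fun x => (x.2.1, x.1, x.2.2), fun x => (x.2.1, x.1, x.2.2), fun _ => rfl, fun _ => rfl⟩
    have h := vN_traceout_eq_add e v hon U χ hU hχ
      (fun i s t => hv i t.1 s t.2) ρ hρ hsupp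
    simp only [Fintype.sum_prod_type] at h
    exact h
  · obtain ⟨U, χ, hU, hχ, hv⟩ := hrec
    let e : Fin d3 × (Fin d1 × Fin d2) ≃ Fin d1 × Fin d2 × Fin d3 :=
      ⟨fun x => (x.2.1, x.2.2, x.1), fun x => (x.2.2, x.1, x.2.1), fun _ => rfl, fun _ => rfl⟩
    have h := vN_traceout_eq_add e v hon U χ hU hχ
      (fun i s t => hv i t.1 t.2 s) ρ hρ hsupp
    simp only [Fintype.sum_prod_type] at h
    exact h
end
end

section
/- Let {|ĩ⟩}_{i=1}^r be an orthonormal family in ℂ^{d1}⊗ℂ^{d2}⊗ℂ^{d3}, and suppose the maximally mixed density ρ̃₀ = (1/r) ∑_{i=1}^r |ĩ⟩⟨ĩ| satisfies I₃(P1:P2:P3)(ρ̃₀) = −2 log r. Then every density matrix ρ̃ supported in span{|ĩ⟩} satisfies I₃(P1:P2:P3)(ρ̃) = −2 S(ρ̃). -/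
open Matrix MeasureTheory ProbabilityTheory
open scoped ComplexOrder BigOperators

noncomputable section

section entropy
variable {n m : Type*} [Fintype n] [DecidableEq n] [Fintype m] [DecidableEq m]

lemma vN_eq_sum_roots {H : Matrix n n ℂ} (h : H.IsHermitian) :
    vN H = (H.charpoly.roots.map fun z => Real.negMulLog z.re).sum := by
  rw [vN, dif_pos h, h.roots_charpoly_eq_eigenvalues, Multiset.map_map, ← Finset.sum_neg_distrib]
  simp [Real.negMulLog]

lemma vN_transpose_s4 {H : Matrix n n ℂ} (h : H.IsHermitian) : vN Hᵀ = vN H := by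
  rw [vN_eq_sum_roots h, vN_eq_sum_roots h.transpose, charpoly_transpose]

lemma vN_mul_conjTranspose (N : Matrix n m ℂ) : vN (N * Nᴴ) = vN (Nᴴ * N) := by
  have hroots := congrArg
    (fun p : Polynomial ℂ => (p.roots.map fun z => Real.negMulLog z.re).sum)
    (charpoly_mul_comm' N Nᴴ)
  have hX (k : ℕ) : (Polynomial.X ^ k : Polynomial ℂ) ≠ 0 := pow_ne_zero _ Polynomial.X_ne_zero
  simp only [Polynomial.roots_mul (mul_ne_zero (hX _) (charpoly_monic _).ne_zero),
    Polynomial.roots_X_pow] at hroots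
  rw [vN_eq_sum_roots (isHermitian_mul_conjTranspose_self N),
    vN_eq_sum_roots (isHermitian_conjTranspose_mul_self N)]
  simpa [Multiset.map_nsmul, Multiset.sum_nsmul] using hroots

/-- A matrix is diagonalised by the unitary `U` with real eigenvalues `d`. -/
def DiagonalizedBy (H U : Matrix n n ℂ) (d : n → ℝ) : Prop :=
  U * Uᴴ = 1 ∧ Uᴴ * U = 1 ∧ H = U * diagonal (fun k => (d k : ℂ)) * Uᴴ

lemma _root_.Matrix.IsHermitian.exists_diagonalizedBy {H : Matrix n n ℂ} (h : H.IsHermitian) :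
    ∃ U, DiagonalizedBy H U h.eigenvalues := by
  refine ⟨h.eigenvectorUnitary, ?_, ?_, ?_⟩
  · exact Unitary.mul_star_self_of_mem h.eigenvectorUnitary.2
  · exact Unitary.star_mul_self_of_mem h.eigenvectorUnitary.2
  · conv_lhs => rw [h.spectral_theorem, Unitary.conjStarAlgAut_apply]
    rfl

lemma DiagonalizedBy.isHermitian {H U : Matrix n n ℂ} {d : n → ℝ} (h : DiagonalizedBy H U d) :
    H.IsHermitian := by
  rw [h.2.2]
  exact isHermitian_mul_mul_conjTranspose U (isHermitian_diagonal_of_self_adjoint _ (by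
    ext k; simp))

lemma DiagonalizedBy.vN_eq {H U : Matrix n n ℂ} {d : n → ℝ} (h : DiagonalizedBy H U d) :
    vN H = ∑ k, Real.negMulLog (d k) := by
  rw [vN_eq_sum_roots h.isHermitian, h.2.2, charpoly_mul_comm, ← mul_assoc, h.2.1, one_mul,
    charpoly_diagonal, Polynomial.roots_prod _ _
      (Finset.prod_ne_zero_iff.2 fun i _ => Polynomial.X_sub_C_ne_zero _)]
  simp

lemma DiagonalizedBy.trace_eq {H U : Matrix n n ℂ} {d : n → ℝ} (h : DiagonalizedBy H U d) :
    H.trace = ∑ k, (d k : ℂ) := by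
  rw [h.2.2, trace_mul_comm, ← mul_assoc, h.2.1, one_mul, trace_diagonal]

lemma DiagonalizedBy.kronecker {H U : Matrix n n ℂ} {d : n → ℝ} {K V : Matrix m m ℂ} {e : m → ℝ}
    (h : DiagonalizedBy H U d) (k : DiagonalizedBy K V e) :
    DiagonalizedBy (kroneckerMap (· * ·) H K) (kroneckerMap (· * ·) U V)
      (fun x => d x.1 * e x.2) := by
  obtain ⟨h₁, h₂, h₃⟩ := h
  obtain ⟨k₁, k₂, k₃⟩ := k
  refine ⟨?_, ?_, ?_⟩
  · rw [conjTranspose_kronecker, ← mul_kronecker_mul, h₁, k₁, one_kronecker_one]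
  · rw [conjTranspose_kronecker, ← mul_kronecker_mul, h₂, k₂, one_kronecker_one]
  · have := diagonal_kronecker_diagonal (fun i => (d i : ℂ)) (fun i => (e i : ℂ))
    push_cast
    rw [← this, conjTranspose_kronecker, ← mul_kronecker_mul, ← mul_kronecker_mul, ← h₃, ← k₃]

/-- The entropy is additive on product states. -/
lemma vN_kronecker_s4 {H : Matrix n n ℂ} {K : Matrix m m ℂ} (hH : H.IsHermitian) (hK : K.IsHermitian)
    (tH : H.trace = 1) (tK : K.trace = 1) :
    vN (kroneckerMap (· * ·) H K) = vN H + vN K := by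
  obtain ⟨U, h⟩ := hH.exists_diagonalizedBy
  obtain ⟨V, k⟩ := hK.exists_diagonalizedBy
  have sd : ∑ i, hH.eigenvalues i = 1 := by exact_mod_cast h.trace_eq.symm.trans tH
  have se : ∑ i, hK.eigenvalues i = 1 := by exact_mod_cast k.trace_eq.symm.trans tK
  rw [(h.kronecker k).vN_eq, h.vN_eq, k.vN_eq, Fintype.sum_prod_type]
  simp only [Real.negMulLog_mul, Finset.sum_add_distrib, ← Finset.mul_sum, ← Finset.sum_mul, sd, se]
  ring

lemma mul_log_sub_mul_log_sub_add_nonneg {l s : ℝ} (hl : 0 ≤ l) (hs : 0 < s) :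
    0 ≤ l * Real.log l - l * Real.log s - l + s ∧
      (l * Real.log l - l * Real.log s - l + s = 0 → l = s) := by
  rcases hl.eq_or_lt with rfl | hl
  · simp only [zero_mul, sub_zero, zero_add]
    exact ⟨hs.le, Eq.symm⟩
  have key : l * (s / l - 1 - Real.log (s / l)) = l * Real.log l - l * Real.log s - l + s := by
    rw [Real.log_div hs.ne' hl.ne']
    field_simp
    ring
  rw [← key]
  refine ⟨mul_nonneg hl.le (by linarith [Real.log_le_sub_one_of_pos (div_pos hs hl)]), fun h => ?_⟩
  by_contra hne
  have := Real.log_lt_sub_one_of_pos (div_pos hs hl) (by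
    rw [Ne, div_eq_one_iff_eq hl.ne']; exact fun h => hne h.symm)
  rcases mul_eq_zero.1 h with h | h <;> linarith

/-- **Klein's inequality** relative to a diagonal matrix, with its equality case. -/
lemma vN_le_neg_sum_mul_log {τ : Matrix n n ℂ} (hτ : τ.PosSemidef) {s : n → ℝ}
    (hs : ∀ x, 0 ≤ s x) (h0 : ∀ x, s x = 0 → τ x x = 0) (htr : (∑ x, s x : ℂ) = τ.trace) :
    vN τ ≤ -∑ x, (τ x x).re * Real.log (s x) ∧
      (vN τ = -∑ x, (τ x x).re * Real.log (s x) → τ = diagonal fun x => (s x : ℂ)) := by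
  obtain ⟨W, hW⟩ := hτ.1.exists_diagonalizedBy
  have hl (k : n) := hτ.eigenvalues_nonneg k
  set l := hτ.1.eigenvalues
  have hvN := hW.vN_eq
  have htrl := hW.trace_eq
  obtain ⟨hW₁, hW₂, hW₃⟩ := hW
  have diag (x : n) : τ x x = ((∑ k, Complex.normSq (W x k) * l k : ℝ) : ℂ) := by
    conv_lhs => rw [hW₃]
    rw [mul_apply]
    push_cast
    refine Finset.sum_congr rfl fun k _ => ?_
    rw [mul_diagonal, conjTranspose_apply, Complex.normSq_eq_conj_mul_self]
    simp only [RCLike.star_def]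
    ring
  have row (x : n) : ∑ k, Complex.normSq (W x k) = 1 := by
    have := congrFun (congrFun hW₁ x) x
    rw [mul_apply, one_apply_eq] at this
    have h2 : ((∑ k, Complex.normSq (W x k) : ℝ) : ℂ) = 1 := by
      rw [← this]
      push_cast
      refine Finset.sum_congr rfl fun k _ => ?_
      rw [conjTranspose_apply, Complex.normSq_eq_conj_mul_self, mul_comm]; rfl
    exact_mod_cast h2
  have col (k : n) : ∑ x, Complex.normSq (W x k) = 1 := by
    have := congrFun (congrFun hW₂ k) k
    rw [mul_apply, one_apply_eq] at this
    have h2 : ((∑ x, Complex.normSq (W x k) : ℝ) : ℂ) = 1 := by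
      rw [← this]
      push_cast
      refine Finset.sum_congr rfl fun k _ => ?_
      rw [conjTranspose_apply, Complex.normSq_eq_conj_mul_self]; rfl
    exact_mod_cast h2
  have term (x k : n) :
      0 ≤ Complex.normSq (W x k) * (l k * Real.log (l k) - l k * Real.log (s x) - l k + s x) ∧
      (Complex.normSq (W x k) * (l k * Real.log (l k) - l k * Real.log (s x) - l k + s x) = 0 →
        W x k = 0 ∨ l k = s x) := by
    rcases (hs x).eq_or_lt with hsx | hsx
    · have h1 : ∑ k, Complex.normSq (W x k) * l k = 0 := by
        exact_mod_cast (diag x).symm.trans (h0 x hsx.symm)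
      rw [Finset.sum_eq_zero_iff_of_nonneg
        fun k _ => mul_nonneg (Complex.normSq_nonneg _) (hl k)] at h1
      rcases mul_eq_zero.1 (h1 k (Finset.mem_univ k)) with h | h
      · simp [Complex.normSq_eq_zero.1 h]
      · simp [h, ← hsx]
    · obtain ⟨ha, hb⟩ := mul_log_sub_mul_log_sub_add_nonneg (hl k) hsx
      refine ⟨mul_nonneg (Complex.normSq_nonneg _) ha, fun h => ?_⟩
      exact (mul_eq_zero.1 h).imp Complex.normSq_eq_zero.1 hb
  have htr' : ∑ x, s x = ∑ k, l k := by exact_mod_cast htr.trans htrl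
  have total : ∑ x, ∑ k, Complex.normSq (W x k) *
      (l k * Real.log (l k) - l k * Real.log (s x) - l k + s x) =
      -∑ x, (τ x x).re * Real.log (s x) - vN τ := by
    have e1 : ∑ x, ∑ k, Complex.normSq (W x k) * (l k * Real.log (l k) - l k) =
        ∑ k, (l k * Real.log (l k) - l k) := by
      rw [Finset.sum_comm]
      simp only [← Finset.sum_mul, col, one_mul]
    have e2 : ∑ x, ∑ k, Complex.normSq (W x k) * s x = ∑ x, s x := by
      simp only [← Finset.sum_mul, row, one_mul]
    have e3 : ∑ x, ∑ k, Complex.normSq (W x k) * l k * Real.log (s x) =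
        ∑ x, (τ x x).re * Real.log (s x) := by
      simp only [← Finset.sum_mul, diag, Complex.ofReal_re]
    have e4 : vN τ = -∑ k, l k * Real.log (l k) := by
      simp [hvN, Real.negMulLog]
    calc _ = ∑ x, ∑ k, Complex.normSq (W x k) * (l k * Real.log (l k) - l k) -
          ∑ x, ∑ k, Complex.normSq (W x k) * l k * Real.log (s x) +
          ∑ x, ∑ k, Complex.normSq (W x k) * s x := by
          simp only [← Finset.sum_sub_distrib, ← Finset.sum_add_distrib]
          exact Finset.sum_congr rfl fun x _ => Finset.sum_congr rfl fun k _ => by ring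
      _ = _ := by rw [e1, e2, e3, e4, Finset.sum_sub_distrib, htr']; ring
  have inner_nonneg (x : n) := Finset.sum_nonneg fun k (_ : k ∈ Finset.univ) => (term x k).1
  refine ⟨by linarith [Finset.sum_nonneg fun x (_ : x ∈ Finset.univ) => inner_nonneg x],
    fun heq => ?_⟩
  rw [heq, sub_self, Finset.sum_eq_zero_iff_of_nonneg fun x _ => inner_nonneg x] at total
  have hcomm : W * diagonal (fun k => (l k : ℂ)) = diagonal (fun x => (s x : ℂ)) * W := by
    ext x k
    rw [mul_diagonal, diagonal_mul]
    have := (Finset.sum_eq_zero_iff_of_nonneg fun k _ => (term x k).1).1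
      (total x (Finset.mem_univ x)) k (Finset.mem_univ k)
    rcases (term x k).2 this with h | h
    · simp [h]
    · rw [h, mul_comm]
  rw [hW₃, hcomm, mul_assoc, hW₁, mul_one]

end entropy

section bipartite
variable {P R : Type*}

/-- Partial trace over the second factor. -/
def trRight [Fintype R] (τ : Matrix (P × R) (P × R) ℂ) : Matrix P P ℂ :=
  Matrix.of fun p p' => ∑ i, τ (p, i) (p', i)

/-- Partial trace over the first factor. -/
def trLeft [Fintype P] (τ : Matrix (P × R) (P × R) ℂ) : Matrix R R ℂ :=
  Matrix.of fun i i' => ∑ p, τ (p, i) (p, i')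

lemma trLeft_eq [Fintype P] (τ : Matrix (P × R) (P × R) ℂ) :
    trLeft τ = trRight (τ.submatrix (Equiv.prodComm R P) (Equiv.prodComm R P)) := rfl

lemma isHermitian_trRight [Fintype R] {τ : Matrix (P × R) (P × R) ℂ} (h : τ.IsHermitian) :
    (trRight τ).IsHermitian := by
  ext p p'
  simp [trRight, h.apply]

lemma isHermitian_trLeft [Fintype P] {τ : Matrix (P × R) (P × R) ℂ} (h : τ.IsHermitian) :
    (trLeft τ).IsHermitian :=
  isHermitian_trRight (h.submatrix (Equiv.prodComm R P))

variable [Fintype P] [Fintype R]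

lemma trRight_conj_kronecker [DecidableEq R] (τ : Matrix (P × R) (P × R) ℂ) (U : Matrix P P ℂ)
    {V : Matrix R R ℂ} (hV : V * Vᴴ = 1) :
    trRight ((kroneckerMap (· * ·) U V)ᴴ * τ * kroneckerMap (· * ·) U V) =
      Uᴴ * trRight τ * U := by
  have hV' (j j' : R) : ∑ i, V j' i * star (V j i) = if j' = j then 1 else 0 := by
    have := congrFun (congrFun hV j') j
    rwa [mul_apply, one_apply] at this
  ext a a'
  simp only [trRight, of_apply, mul_apply, Finset.sum_mul, Finset.mul_sum, conjTranspose_apply,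
    kroneckerMap_apply, Fintype.sum_prod_type, star_mul']
  calc _ = ∑ p', ∑ j', ∑ p, ∑ j, (∑ i, V j' i * star (V j i)) *
        (star (U p a) * τ (p, j) (p', j') * U p' a') := by
        rw [Finset.sum_comm]
        refine Finset.sum_congr rfl fun p' _ => ?_
        rw [Finset.sum_comm]
        refine Finset.sum_congr rfl fun j' _ => ?_
        rw [Finset.sum_comm]
        refine Finset.sum_congr rfl fun p _ => ?_
        rw [Finset.sum_comm]
        refine Finset.sum_congr rfl fun j _ => ?_
        rw [Finset.sum_mul]
        exact Finset.sum_congr rfl fun i _ => by ring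
    _ = _ := by
        simp only [hV', ite_mul, one_mul, zero_mul, Finset.sum_ite_eq, Finset.mem_univ, if_true]
        exact Finset.sum_congr rfl fun p' _ => Finset.sum_comm

lemma trLeft_conj_kronecker [DecidableEq P] (τ : Matrix (P × R) (P × R) ℂ) {U : Matrix P P ℂ}
    (V : Matrix R R ℂ) (hU : U * Uᴴ = 1) :
    trLeft ((kroneckerMap (· * ·) U V)ᴴ * τ * kroneckerMap (· * ·) U V) =
      Vᴴ * trLeft τ * V := by
  have hswap : (kroneckerMap (· * ·) U V).submatrix (Equiv.prodComm R P) (Equiv.prodComm R P) =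
      kroneckerMap (· * ·) V U := by
    ext x y
    exact mul_comm _ _
  rw [trLeft_eq, trLeft_eq, ← trRight_conj_kronecker _ V hU, ← hswap, conjTranspose_submatrix,
    submatrix_mul_equiv, submatrix_mul_equiv]

variable [DecidableEq R]

lemma vN_conj {τ U : Matrix R R ℂ} (hτ : τ.IsHermitian) (hU : U * Uᴴ = 1) :
    vN (Uᴴ * τ * U) = vN τ := by
  rw [vN_eq_sum_roots hτ, vN_eq_sum_roots (isHermitian_conjTranspose_mul_mul U hτ),
    charpoly_mul_comm, ← mul_assoc, hU, one_mul]

variable [DecidableEq P]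

/-- **Subadditivity** of the entropy, with its equality case. -/
lemma vN_subadditive {τ : Matrix (P × R) (P × R) ℂ} (hτ : τ.PosSemidef) (htr : τ.trace = 1) :
    vN τ ≤ vN (trRight τ) + vN (trLeft τ) ∧
      (vN τ = vN (trRight τ) + vN (trLeft τ) →
        τ = kroneckerMap (· * ·) (trRight τ) (trLeft τ)) := by
  obtain ⟨U, hU⟩ := (isHermitian_trRight hτ.1).exists_diagonalizedBy
  obtain ⟨V, hV⟩ := (isHermitian_trLeft hτ.1).exists_diagonalizedBy
  set d := (isHermitian_trRight hτ.1).eigenvalues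
  set e := (isHermitian_trLeft hτ.1).eigenvalues
  have hUV := hU.kronecker hV
  have vR := hU.vN_eq
  have vL := hV.vN_eq
  obtain ⟨hU₁, hU₂, hU₃⟩ := hU
  obtain ⟨hV₁, hV₂, hV₃⟩ := hV
  set W := kroneckerMap (· * ·) U V with hW
  set τ' := Wᴴ * τ * W with hτ'
  have psd : τ'.PosSemidef := hτ.conjTranspose_mul_mul_same W
  have real (x : P × R) : (((τ' x x).re : ℝ) : ℂ) = τ' x x :=
    Complex.ext rfl (Complex.nonneg_iff.1 psd.diag_nonneg).2
  have pos (x : P × R) : 0 ≤ (τ' x x).re := (Complex.nonneg_iff.1 psd.diag_nonneg).1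
  have margR (a : P) : ∑ i, (τ' (a, i) (a, i)).re = d a := by
    have h := trRight_conj_kronecker τ U hV₁
    rw [hU₃] at h
    have h2 : Uᴴ * (U * diagonal (fun k => (d k : ℂ)) * Uᴴ) * U = diagonal fun k => (d k : ℂ) := by
      rw [mul_assoc, mul_assoc, mul_assoc, hU₂, mul_one, ← mul_assoc, hU₂, one_mul]
    have h3 := congrFun (congrFun (h.trans h2) a) a
    rw [diagonal_apply_eq] at h3
    have := congrArg Complex.re h3
    simpa [trRight] using this
  have margL (i : R) : ∑ a, (τ' (a, i) (a, i)).re = e i := by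
    have h := trLeft_conj_kronecker τ V hU₁
    rw [hV₃] at h
    have h2 : Vᴴ * (V * diagonal (fun k => (e k : ℂ)) * Vᴴ) * V = diagonal fun k => (e k : ℂ) := by
      rw [mul_assoc, mul_assoc, mul_assoc, hV₂, mul_one, ← mul_assoc, hV₂, one_mul]
    have h3 := congrFun (congrFun (h.trans h2) i) i
    rw [diagonal_apply_eq] at h3
    have := congrArg Complex.re h3
    simpa [trLeft] using this
  have d0 (a : P) : 0 ≤ d a := margR a ▸ Finset.sum_nonneg fun i _ => pos _
  have e0 (i : R) : 0 ≤ e i := margL i ▸ Finset.sum_nonneg fun a _ => pos _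
  have zeroR (a : P) (i : R) (h : d a = 0) : (τ' (a, i) (a, i)).re = 0 :=
    (Finset.sum_eq_zero_iff_of_nonneg fun i _ => pos (a, i)).1 ((margR a).trans h) i
      (Finset.mem_univ i)
  have zeroL (a : P) (i : R) (h : e i = 0) : (τ' (a, i) (a, i)).re = 0 :=
    (Finset.sum_eq_zero_iff_of_nonneg fun a _ => pos (a, i)).1 ((margL i).trans h) a
      (Finset.mem_univ a)
  have tr' : τ'.trace = 1 := by
    rw [hτ', trace_mul_comm, ← mul_assoc, hUV.1, one_mul, htr]
  have tot : ∑ a, ∑ i, (τ' (a, i) (a, i)).re = 1 := by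
    have := congrArg Complex.re tr'
    simpa [trace, Fintype.sum_prod_type] using this
  have sd : ∑ a, d a = 1 := by simpa only [margR] using tot
  have se : ∑ i, e i = 1 := by
    rw [Finset.sum_comm] at tot
    simpa only [margL] using tot
  obtain ⟨hle, heq⟩ := vN_le_neg_sum_mul_log psd (s := fun x => d x.1 * e x.2)
    (fun x => mul_nonneg (d0 _) (e0 _))
    (fun x hx => by
      rw [← real x, Complex.ofReal_eq_zero]
      rcases mul_eq_zero.1 hx with h | h
      exacts [zeroR _ _ h, zeroL _ _ h])
    (by
      rw [tr', ← Complex.ofReal_sum, Fintype.sum_prod_type]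
      simp only [← Finset.mul_sum, se, mul_one, sd, Complex.ofReal_one])
  have hsum : -∑ x, (τ' x x).re * Real.log (d x.1 * e x.2) =
      vN (trRight τ) + vN (trLeft τ) := by
    have hlog (a : P) (i : R) : (τ' (a, i) (a, i)).re * Real.log (d a * e i) =
        (τ' (a, i) (a, i)).re * Real.log (d a) + (τ' (a, i) (a, i)).re * Real.log (e i) := by
      by_cases ha : d a = 0
      · simp [zeroR a i ha]
      by_cases hi : e i = 0
      · simp [zeroL a i hi]
      rw [Real.log_mul ha hi, mul_add]
    rw [vR, vL, Fintype.sum_prod_type]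
    simp only [hlog, Finset.sum_add_distrib]
    rw [Finset.sum_comm (f := fun a i => (τ' (a, i) (a, i)).re * Real.log (e i))]
    simp only [← Finset.sum_mul, margR, margL, Real.negMulLog, neg_mul, Finset.sum_neg_distrib]
    ring
  rw [hsum, vN_conj hτ.1 hUV.1] at hle heq
  refine ⟨hle, fun h => ?_⟩
  rw [hUV.2.2]
  push_cast at heq ⊢
  rw [← heq h, hτ', ← mul_assoc, ← mul_assoc, hUV.1, one_mul, mul_assoc, hUV.1, mul_one]

end bipartite

section purification
variable {X P Q R R' : Type*}

/-- Marginal on the first factor of a decomposition `P × Q ≃ X`. -/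
def marginal [Fintype Q] (e : P × Q ≃ X) (ρ : Matrix X X ℂ) : Matrix P P ℂ :=
  trRight (ρ.submatrix e e)

/-- Marginal on the second factor of a decomposition `P × Q ≃ X`. -/
def comarginal [Fintype P] (e : P × Q ≃ X) (ρ : Matrix X X ℂ) : Matrix Q Q ℂ :=
  trLeft (ρ.submatrix e e)

/-- The amplitudes of a pure state on `X × R`, regrouped along the cut `P × R` versus `Q`. -/
def regroup (e : P × Q ≃ X) (ψ : Matrix X R ℂ) : Matrix (P × R) Q ℂ :=
  Matrix.of fun x q => ψ (e (x.1, q)) x.2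

lemma trRight_regroup [Fintype Q] [Fintype R] (e : P × Q ≃ X) (ψ : Matrix X R ℂ) :
    trRight (regroup e ψ * (regroup e ψ)ᴴ) = marginal e (ψ * ψᴴ) := by
  ext p p'
  simp only [trRight, marginal, regroup, of_apply, mul_apply, conjTranspose_apply, submatrix_apply]
  exact Finset.sum_comm

lemma trLeft_regroup [Fintype X] [Fintype P] [Fintype Q] (e : P × Q ≃ X) (ψ : Matrix X R ℂ) :
    trLeft (regroup e ψ * (regroup e ψ)ᴴ) = (ψᴴ * ψ)ᵀ := by
  ext i j
  simp only [trLeft, regroup, of_apply, mul_apply, conjTranspose_apply, transpose_apply]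
  rw [← e.sum_comp, Fintype.sum_prod_type]
  exact Finset.sum_congr rfl fun _ _ => Finset.sum_congr rfl fun _ _ => mul_comm _ _

lemma regroup_conjTranspose_mul [Fintype P] [Fintype R] (e : P × Q ≃ X) (ψ : Matrix X R ℂ) :
    ((regroup e ψ)ᴴ * regroup e ψ)ᵀ = comarginal e (ψ * ψᴴ) := by
  ext q q'
  simp only [trLeft, comarginal, regroup, of_apply, mul_apply, conjTranspose_apply,
    transpose_apply, submatrix_apply, Fintype.sum_prod_type]
  exact Finset.sum_congr rfl fun _ _ => Finset.sum_congr rfl fun _ _ => mul_comm _ _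

lemma trace_regroup [Fintype X] [Fintype P] [Fintype Q] [Fintype R] (e : P × Q ≃ X)
    (ψ : Matrix X R ℂ) :
    (regroup e ψ * (regroup e ψ)ᴴ).trace = (ψ * ψᴴ).trace := by
  rw [trace_mul_comm ψ, ← trace_transpose (ψᴴ * ψ), ← trLeft_regroup e]
  simp only [trace, diag_apply, Fintype.sum_prod_type, trLeft, of_apply]
  exact Finset.sum_comm

lemma regroup_mul [Fintype P] [Fintype R] [DecidableEq P] (e : P × Q ≃ X) (ψ : Matrix X R ℂ)
    (L : Matrix R R' ℂ) :
    regroup e (ψ * L) = kroneckerMap (· * ·) (1 : Matrix P P ℂ) Lᵀ * regroup e ψ := by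
  ext x q
  simp [regroup, mul_apply, Fintype.sum_prod_type, one_apply, mul_comm]

variable [Fintype X] [Fintype P] [Fintype Q] [Fintype R] [Fintype R']
  [DecidableEq P] [DecidableEq Q] [DecidableEq R] [DecidableEq R']

/-- The mutual information between `P` and the purifying system `R` in the pure state `ψ`. -/
def mutualInfo (e : P × Q ≃ X) (ψ : Matrix X R ℂ) : ℝ :=
  vN (marginal e (ψ * ψᴴ)) + vN (ψᴴ * ψ) - vN (comarginal e (ψ * ψᴴ))

lemma mutualInfo_eq (e : P × Q ≃ X) (ψ : Matrix X R ℂ) :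
    mutualInfo e ψ = vN (trRight (regroup e ψ * (regroup e ψ)ᴴ)) +
      vN (trLeft (regroup e ψ * (regroup e ψ)ᴴ)) - vN (regroup e ψ * (regroup e ψ)ᴴ) := by
  rw [mutualInfo, trRight_regroup, trLeft_regroup, ← regroup_conjTranspose_mul,
    vN_transpose_s4 (isHermitian_conjTranspose_mul_self _),
    vN_transpose_s4 (isHermitian_conjTranspose_mul_self _), vN_mul_conjTranspose (regroup e ψ)]

lemma mutualInfo_nonneg (e : P × Q ≃ X) {ψ : Matrix X R ℂ} (h : (ψ * ψᴴ).trace = 1) :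
    0 ≤ mutualInfo e ψ := by
  rw [mutualInfo_eq]
  linarith [(vN_subadditive (posSemidef_self_mul_conjTranspose (regroup e ψ))
    ((trace_regroup e ψ).trans h)).1]

/-- Decoupling from the purifying system is preserved by operations on that system. -/
lemma mutualInfo_mul_eq_zero (e : P × Q ≃ X) {ψ : Matrix X R ℂ} (h : (ψ * ψᴴ).trace = 1)
    (h0 : mutualInfo e ψ = 0) (L : Matrix R R' ℂ) (hL : (ψ * L * (ψ * L)ᴴ).trace = 1) :
    mutualInfo e (ψ * L) = 0 := by
  have hτ := posSemidef_self_mul_conjTranspose (regroup e ψ)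
  have htr := (trace_regroup e ψ).trans h
  rw [mutualInfo_eq, sub_eq_zero] at h0
  have hprod := (vN_subadditive hτ htr).2 h0.symm
  set σ := trRight (regroup e ψ * (regroup e ψ)ᴴ)
  have hσ : σ.IsHermitian := isHermitian_trRight hτ.1
  have tσ : σ.trace = 1 := by
    rw [← htr]
    simp only [σ, trace, diag_apply, Fintype.sum_prod_type, trRight, of_apply]
  have tK : ((ψ * L)ᴴ * (ψ * L))ᵀ.trace = 1 := by rw [trace_transpose, trace_mul_comm, hL]
  have hK : ((ψ * L)ᴴ * (ψ * L))ᵀ.IsHermitian := (isHermitian_conjTranspose_mul_self _).transpose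
  have key : regroup e (ψ * L) * (regroup e (ψ * L))ᴴ =
      kroneckerMap (· * ·) σ ((ψ * L)ᴴ * (ψ * L))ᵀ := by
    rw [regroup_mul, conjTranspose_mul, Matrix.mul_assoc, ← Matrix.mul_assoc (regroup e ψ), hprod,
      trLeft_regroup, conjTranspose_kronecker, ← mul_kronecker_mul, ← mul_kronecker_mul]
    simp only [conjTranspose_one, Matrix.one_mul, Matrix.mul_one, conjTranspose_mul, transpose_mul,
      Matrix.mul_assoc]
    rfl
  have hR : trRight (kroneckerMap (· * ·) σ ((ψ * L)ᴴ * (ψ * L))ᵀ) = σ := by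
    ext p p'
    have := congrArg (σ p p' * ·) tK
    simpa [trRight, trace, Finset.mul_sum] using this
  rw [mutualInfo_eq, key, vN_kronecker_s4 hσ hK tσ tK, hR, ← key, trLeft_regroup, sub_self]

end purification

section tripartite
variable {α β γ R : Type*} [Fintype α] [Fintype β] [Fintype γ] [Fintype R]
  [DecidableEq α] [DecidableEq β] [DecidableEq γ] [DecidableEq R]

/-- The decomposition singling out party 2. -/
def splitSecond (α β γ : Type*) : β × (α × γ) ≃ α × β × γ where
  toFun x := (x.2.1, x.1, x.2.2)
  invFun x := (x.2.1, x.1, x.2.2)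
  left_inv _ := rfl
  right_inv _ := rfl

/-- The decomposition singling out party 3. -/
def splitThird (α β γ : Type*) : γ × (α × β) ≃ α × β × γ where
  toFun x := (x.2.1, x.2.2, x.1)
  invFun x := (x.2.2, x.1, x.2.1)
  left_inv _ := rfl
  right_inv _ := rfl

lemma I3_add_two_mul_vN (ψ : Matrix (α × β × γ) R ℂ) :
    I3 (ψ * ψᴴ) + 2 * vN (ψ * ψᴴ) = mutualInfo (Equiv.refl (α × β × γ)) ψ +
      mutualInfo (splitSecond α β γ) ψ + mutualInfo (splitThird α β γ) ψ := by
  set ρ := ψ * ψᴴ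
  have h1 : red1 ρ = marginal (Equiv.refl (α × β × γ)) ρ := by
    ext; simp [red1, marginal, trRight, Fintype.sum_prod_type]
  have h2 : red2 ρ = marginal (splitSecond α β γ) ρ := by
    ext; simp [red2, marginal, trRight, Fintype.sum_prod_type, splitSecond]
  have h3 : red3 ρ = marginal (splitThird α β γ) ρ := by
    ext; simp [red3, marginal, trRight, Fintype.sum_prod_type, splitThird]
  have h23 : red23 ρ = comarginal (Equiv.refl (α × β × γ)) ρ := rfl
  have h13 : red13 ρ = comarginal (splitSecond α β γ) ρ := rfl
  have h12 : red12 ρ = comarginal (splitThird α β γ) ρ := rfl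
  simp only [I3, mutualInfo, ← vN_mul_conjTranspose ψ, h1, h2, h3, h23, h13, h12, ρ]
  ring

end tripartite

lemma vN_inv_card_smul_one (r : ℕ) (hr : r ≠ 0) :
    vN ((r : ℂ)⁻¹ • (1 : Matrix (Fin r) (Fin r) ℂ)) = Real.log r := by
  have h : DiagonalizedBy ((r : ℂ)⁻¹ • (1 : Matrix (Fin r) (Fin r) ℂ)) 1 fun _ => (r : ℝ)⁻¹ := by
    refine ⟨by simp, by simp, ?_⟩
    ext i j
    simp [one_apply]
  rw [h.vN_eq]
  have : (r : ℝ) ≠ 0 := by exact_mod_cast hr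
  simp [Real.negMulLog, Real.log_inv]
  field_simp

lemma SuppIn.mul_eq {ι X : Type*} [Fintype ι] [DecidableEq ι] [Fintype X] [DecidableEq X]
    {v : ι → X → ℂ} (hv : (Matrix.of v)ᵀᴴ * (Matrix.of v)ᵀ = 1) {ρ : Matrix X X ℂ}
    (h : SuppIn ρ v) : (Matrix.of v)ᵀ * (Matrix.of v)ᵀᴴ * ρ = ρ := by
  set V := (Matrix.of v)ᵀ with hV
  have hspan : Submodule.span ℂ (Set.range v) ≤
      LinearMap.eqLocus (V * Vᴴ).mulVecLin LinearMap.id := by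
    rw [Submodule.span_le]
    rintro _ ⟨i, rfl⟩
    have hi : v i = V *ᵥ Pi.single i 1 := by
      ext x; simp [hV]
    simp only [SetLike.mem_coe, LinearMap.mem_eqLocus, mulVecLin_apply, LinearMap.id_apply]
    rw [hi, mulVec_mulVec, Matrix.mul_assoc, hv, Matrix.mul_one]
  refine ext_of_mulVec_single fun x => ?_
  rw [← mulVec_mulVec]
  exact hspan (h ⟨Pi.single x 1, rfl⟩)

open scoped MatrixOrder Matrix.Norms.L2Operator in
lemma _root_.Matrix.PosSemidef.exists_eq_conjTranspose_mul_self {X : Type*} [Fintype X]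
    [DecidableEq X] {ρ : Matrix X X ℂ} (h : ρ.PosSemidef) : ∃ B : Matrix X X ℂ, ρ = Bᴴ * B :=
  CStarAlgebra.nonneg_iff_eq_star_mul_self.1 h.nonneg

/-- if the maximally mixed density on the code space has minimal tripartite
information `I₃ = −2 log r`, then every density matrix `ρ̃` supported in the code space
satisfies `I₃(ρ̃) = −2 S(ρ̃)`. -/
theorem stmt4 (d1 d2 d3 r : ℕ)
    (v : Fin r → (Fin d1 × Fin d2 × Fin d3) → ℂ) (hon : ONFam v)
    (hmin : I3 ((r : ℂ)⁻¹ • ∑ i, outer (v i) (v i)) = -2 * Real.log r)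
    (ρ : Matrix (Fin d1 × Fin d2 × Fin d3) (Fin d1 × Fin d2 × Fin d3) ℂ)
    (hρ : IsDensity ρ) (hsupp : SuppIn ρ v) :
    I3 ρ = -2 * vN ρ := by
  set V := (Matrix.of v)ᵀ with hV
  have hVV : Vᴴ * V = 1 := by
    ext i j
    rw [mul_apply, one_apply]
    exact hon i j
  have hVρ : V * Vᴴ * ρ = ρ := hsupp.mul_eq hVV
  have hr : r ≠ 0 := by
    rintro rfl
    have h0 : ρ = 0 := by
      rw [← hVρ, show V * Vᴴ = 0 by ext; simp [mul_apply], Matrix.zero_mul]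
    simpa [h0] using hρ.2
  have hrC : (r : ℂ) ≠ 0 := by exact_mod_cast hr
  obtain ⟨c, hc⟩ : ∃ c : ℝ, (c : ℂ) * c = (r : ℂ)⁻¹ :=
    ⟨Real.sqrt (r : ℝ)⁻¹, by
      rw [← Complex.ofReal_mul, Real.mul_self_sqrt (by positivity)]; simp⟩
  have hc0 : (c : ℂ) ≠ 0 := by
    rintro h
    rw [h, zero_mul] at hc
    exact inv_ne_zero hrC hc.symm
  set ψ := (c : ℂ) • V with hψ
  have hψH : ψᴴ = (c : ℂ) • Vᴴ := by simp [hψ, conjTranspose_smul]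
  have hψ₀ : ψ * ψᴴ = (r : ℂ)⁻¹ • ∑ i, outer (v i) (v i) := by
    rw [hψH, hψ, Matrix.smul_mul, Matrix.mul_smul, smul_smul, hc]
    congr 1
    ext x y
    simp [mul_apply, Matrix.sum_apply, outer, hV]
  have hψ₁ : ψᴴ * ψ = (r : ℂ)⁻¹ • 1 := by
    rw [hψH, hψ, Matrix.smul_mul, Matrix.mul_smul, smul_smul, hc, hVV]
  have hψtr : (ψ * ψᴴ).trace = 1 := by
    rw [trace_mul_comm, hψ₁]
    simp [hrC]
  have hsum := I3_add_two_mul_vN ψ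
  rw [vN_mul_conjTranspose ψ, hψ₁, vN_inv_card_smul_one r hr, hψ₀, hmin] at hsum
  have n1 := mutualInfo_nonneg (Equiv.refl (Fin d1 × Fin d2 × Fin d3)) hψtr
  have n2 := mutualInfo_nonneg (splitSecond (Fin d1) (Fin d2) (Fin d3)) hψtr
  have n3 := mutualInfo_nonneg (splitThird (Fin d1) (Fin d2) (Fin d3)) hψtr
  obtain ⟨B, hB⟩ := hρ.1.exists_eq_conjTranspose_mul_self
  set L := (c : ℂ)⁻¹ • (Vᴴ * Bᴴ)
  have hψL : ψ * L = V * Vᴴ * Bᴴ := by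
    rw [hψ, Matrix.smul_mul, Matrix.mul_smul, smul_smul, mul_inv_cancel₀ hc0, one_smul,
      Matrix.mul_assoc]
  have hρL : ψ * L * (ψ * L)ᴴ = ρ := by
    have h2 : ρ * (V * Vᴴ) = ρ := by
      have := congrArg conjTranspose hVρ
      rwa [conjTranspose_mul, hρ.1.1.eq, (isHermitian_mul_conjTranspose_self V).eq] at this
    rw [hψL, conjTranspose_mul, conjTranspose_conjTranspose,
      (isHermitian_mul_conjTranspose_self V).eq, Matrix.mul_assoc, ← Matrix.mul_assoc Bᴴ,
      ← hB, h2, hVρ]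
  have hLtr : (ψ * L * (ψ * L)ᴴ).trace = 1 := by rw [hρL, hρ.2]
  have hfinal := I3_add_two_mul_vN (ψ * L)
  rw [mutualInfo_mul_eq_zero _ hψtr (by linarith) L hLtr,
    mutualInfo_mul_eq_zero _ hψtr (by linarith) L hLtr,
    mutualInfo_mul_eq_zero _ hψtr (by linarith) L hLtr, hρL] at hfinal
  linarith
end
end

section
/- Let d, r ≥ 1 and t : Fin r × (Fin d)³ → ℂ be such that the vectors |ĩ⟩ = d^{-1/2} ∑_{s1,s2,s3} t(i,s1,s2,s3)|s1⟩⊗|s2⟩⊗|s3⟩ are orthonormal. Let ρ̃ be any density matrix supported in span{|ĩ⟩}, |φ⟩ a purification of ρ̃, and ρ^{RP1}, ρ^R, ρ^{P1} the corresponding reduced densities. Then the quantum relative entropy satisfies D(ρ^{RP1} ‖ ρ^R ⊗ ρ^{P1}) ≤ 2 log ‖t⁽¹⁾‖_∞, where t⁽¹⁾((s2,s3),(i,s1)) = t(i,s1,s2,s3). -/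
open Matrix MeasureTheory ProbabilityTheory
open scoped ComplexOrder BigOperators

noncomputable section

theorem mlog_eq_of_spectral {n : Type*} [Fintype n] [DecidableEq n] (σ U : Matrix n n ℂ)
    (hU : U * Uᴴ = 1) (q : n → ℝ)
    (hσ : σ = U * diagonal (fun k => (q k : ℂ)) * Uᴴ) :
    mlog σ = U * diagonal (fun k => (Real.log (q k) : ℂ)) * Uᴴ := by
  have hU' : Uᴴ * U = 1 := mul_eq_one_comm.mp hU
  have h : σ.IsHermitian := by
    rw [hσ]
    exact isHermitian_mul_mul_conjTranspose _
      (isHermitian_diagonal_of_self_adjoint _ (by ext k; simp))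
  rw [mlog, dif_pos h]
  set V : Matrix n n ℂ := (h.eigenvectorUnitary : Matrix n n ℂ)
  have hV : V * Vᴴ = 1 := Unitary.mul_star_self_of_mem h.eigenvectorUnitary.2
  have hV' : Vᴴ * V = 1 := mul_eq_one_comm.mp hV
  have hs : σ = V * diagonal (fun k => (h.eigenvalues k : ℂ)) * Vᴴ := h.spectral_theorem
  have key : diagonal (fun k => (h.eigenvalues k : ℂ)) * (Vᴴ * U)
      = (Vᴴ * U) * diagonal (fun k => (q k : ℂ)) := by
    calc _ = Vᴴ * (V * diagonal (fun k => (h.eigenvalues k : ℂ)) * Vᴴ) * U := by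
          simp only [← Matrix.mul_assoc, hV', Matrix.one_mul]
      _ = Vᴴ * (U * diagonal (fun k => (q k : ℂ)) * Uᴴ) * U := by rw [← hs, ← hσ]
      _ = _ := by simp only [Matrix.mul_assoc, hU', Matrix.mul_one]
  have key2 : diagonal (fun k => (Real.log (h.eigenvalues k) : ℂ)) * (Vᴴ * U)
      = (Vᴴ * U) * diagonal (fun k => (Real.log (q k) : ℂ)) := by
    ext i j
    have hij := congrFun (congrFun key i) j
    rw [diagonal_mul, mul_diagonal] at hij ⊢
    rcases eq_or_ne ((Vᴴ * U) i j) 0 with h0 | h0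
    · simp [h0]
    · rw [mul_comm] at hij
      have := mul_left_cancel₀ h0 hij
      rw [Complex.ofReal_inj.mp this, mul_comm]
  calc _ = V * (diagonal (fun k => (Real.log (h.eigenvalues k) : ℂ)) * (Vᴴ * U)) * Uᴴ := by
        simp only [Matrix.mul_assoc, hU, Matrix.mul_one]
    _ = _ := by rw [key2]; simp only [← Matrix.mul_assoc, hV, Matrix.one_mul]

theorem trace_spectral_mul_spectral {n : Type*} [Fintype n] [DecidableEq n] (V U : Matrix n n ℂ)
    (p f : n → ℝ) :
    ((V * diagonal (fun k => (p k : ℂ)) * Vᴴ) * (U * diagonal (fun k => (f k : ℂ)) * Uᴴ)).trace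
      = ((∑ i, ∑ j, p i * ‖(Vᴴ * U) i j‖ ^ 2 * f j : ℝ) : ℂ) := by
  have : ((V * diagonal (fun k => (p k : ℂ)) * Vᴴ) * (U * diagonal (fun k => (f k : ℂ)) * Uᴴ)).trace
      = (diagonal (fun k => (p k : ℂ)) * (Vᴴ * U) * diagonal (fun k => (f k : ℂ)) *
          (Vᴴ * U)ᴴ).trace := by
    simp only [Matrix.mul_assoc]
    rw [trace_mul_comm]
    simp only [conjTranspose_mul, conjTranspose_conjTranspose, Matrix.mul_assoc]
  rw [this]
  simp only [trace, diag, Matrix.mul_apply (M := _ * diagonal _), mul_diagonal, diagonal_mul,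
    conjTranspose_apply]
  push_cast
  refine Finset.sum_congr rfl fun i _ => Finset.sum_congr rfl fun j _ => ?_
  have := Complex.mul_conj' ((Vᴴ * U) i j)
  rw [← this]
  simp only [RCLike.star_def]
  ring

theorem sum_log_sub_log_le {I A B : Type*} [Fintype I] [Fintype A] [Fintype B] [DecidableEq A]
    [DecidableEq B] (p : I → ℝ) (a : A → ℝ) (b : B → ℝ)
    (M : I → A × B → ℂ) (K : ℝ) (hp : ∀ i, 0 ≤ p i) (hp1 : ∑ i, p i = 1) (ha : ∀ x, 0 ≤ a x)
    (hM : ∀ i, ∑ j, ‖M i j‖ ^ 2 = 1)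
    (hb : ∀ s, ∑ i, ∑ w, p i * ‖M i (w, s)‖ ^ 2 = b s)
    (hdom : ∀ y : A × B → ℂ, ∑ i, p i * ‖∑ j, M i j * y j‖ ^ 2 ≤ K * ∑ j, a j.1 * ‖y j‖ ^ 2) :
    ∑ i, ∑ j, p i * ‖M i j‖ ^ 2 * (Real.log (p i) - Real.log (a j.1 * b j.2))
      ≤ Real.log (K * Fintype.card B) := by
  have hnn : ∀ i j, 0 ≤ p i * ‖M i j‖ ^ 2 := fun i j => mul_nonneg (hp i) (sq_nonneg _)
  have hWa : ∀ i j, p i * ‖M i j‖ ^ 2 ≤ K * a j.1 := by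
    intro i j
    have h := hdom (Pi.single j 1)
    have e1 : ∀ i, ∑ k, M i k * (Pi.single j 1 : A × B → ℂ) k = M i j := by
      intro i; simp [Pi.single_apply]
    have e2 : ∑ k : A × B, a k.1 * ‖(Pi.single j 1 : A × B → ℂ) k‖ ^ 2 = a j.1 := by
      rw [Finset.sum_eq_single j]
      · simp
      · intro k _ hk; simp [Pi.single_eq_of_ne hk]
      · simp
    simp only [e1, e2] at h
    exact (Finset.single_le_sum (f := fun i => p i * ‖M i j‖ ^ 2) (fun i _ => hnn i j)
      (Finset.mem_univ i)).trans h
  have hWb : ∀ i j, p i * ‖M i j‖ ^ 2 ≤ b j.2 := by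
    intro i j
    rw [← hb]
    calc p i * ‖M i j‖ ^ 2 ≤ ∑ w, p i * ‖M i (w, j.2)‖ ^ 2 :=
          Finset.single_le_sum (f := fun w => p i * ‖M i (w, j.2)‖ ^ 2)
            (fun w _ => hnn i _) (Finset.mem_univ j.1)
      _ ≤ _ := Finset.single_le_sum (f := fun i => ∑ w, p i * ‖M i (w, j.2)‖ ^ 2)
            (fun i _ => Finset.sum_nonneg fun w _ => hnn i _) (Finset.mem_univ i)
  have hsum : ∑ i, ∑ j, p i * ‖M i j‖ ^ 2 = 1 := by
    simp_rw [← Finset.mul_sum, hM, mul_one, hp1]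
  obtain ⟨i₀, j₀, h₀⟩ : ∃ i j, 0 < p i * ‖M i j‖ ^ 2 := by
    by_contra! hcon
    have : ∑ i, ∑ j, p i * ‖M i j‖ ^ 2 ≤ 0 :=
      Finset.sum_nonpos fun i _ => Finset.sum_nonpos fun j _ => hcon i j
    linarith
  have hK : 0 < K := by
    by_contra! hcon
    have := mul_nonpos_of_nonpos_of_nonneg hcon (ha j₀.1)
    linarith [hWa i₀ j₀]
  have hcard : 0 < (Fintype.card B : ℝ) := by
    exact_mod_cast Fintype.card_pos_iff.mpr ⟨j₀.2⟩
  have hterm : ∀ i j, p i * ‖M i j‖ ^ 2 * (Real.log (p i) - Real.log (a j.1 * b j.2)) ≤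
      p i * ‖M i j‖ ^ 2 * (Real.log (K * Fintype.card B) - 2)
        + p i * (p i * (‖M i j‖ ^ 2 * (a j.1)⁻¹)) * K⁻¹
        + p i * ‖M i j‖ ^ 2 * ((b j.2)⁻¹ * (Fintype.card B : ℝ)⁻¹) := by
    intro i j
    rcases (hnn i j).eq_or_lt with h0 | hpos
    · have : p i * (p i * (‖M i j‖ ^ 2 * (a j.1)⁻¹)) * K⁻¹
          = p i * ‖M i j‖ ^ 2 * (p i * (a j.1)⁻¹ * K⁻¹) := by ring
      rw [this, ← h0]; simp
    · have hpi : 0 < p i := pos_of_mul_pos_left hpos (sq_nonneg _)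
      have haj : 0 < a j.1 := pos_of_mul_pos_right (hpos.trans_le (hWa i j)) hK.le
      have hbj : 0 < b j.2 := hpos.trans_le (hWb i j)
      have l1 := Real.log_le_sub_one_of_pos (x := p i * (a j.1)⁻¹ * K⁻¹) (by positivity)
      have l2 := Real.log_le_sub_one_of_pos (x := (b j.2)⁻¹ * (Fintype.card B : ℝ)⁻¹)
        (by positivity)
      rw [Real.log_mul (by positivity) (by positivity), Real.log_mul (by positivity) (by positivity),
        Real.log_inv, Real.log_inv] at l1
      rw [Real.log_mul (by positivity) (by positivity), Real.log_inv, Real.log_inv] at l2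
      have l3 : Real.log (p i) - Real.log (a j.1 * b j.2) ≤ (Real.log (K * Fintype.card B) - 2)
          + p i * (a j.1)⁻¹ * K⁻¹ + (b j.2)⁻¹ * (Fintype.card B : ℝ)⁻¹ := by
        rw [Real.log_mul haj.ne' hbj.ne', Real.log_mul hK.ne' hcard.ne']
        linarith
      refine (mul_le_mul_of_nonneg_left l3 hpos.le).trans_eq ?_
      ring
  have hrow : ∀ i, p i * ∑ j, ‖M i j‖ ^ 2 * (a j.1)⁻¹ ≤ K := by
    intro i
    set S := ∑ j, ‖M i j‖ ^ 2 * (a j.1)⁻¹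
    have hS : 0 ≤ S := Finset.sum_nonneg fun j _ => mul_nonneg (sq_nonneg _) (inv_nonneg.mpr (ha _))
    have h := hdom fun j => star (M i j) * ((a j.1)⁻¹ : ℝ)
    have e1 : ∑ j, M i j * (star (M i j) * ((a j.1)⁻¹ : ℝ)) = (S : ℂ) := by
      push_cast [S]
      refine Finset.sum_congr rfl fun j _ => ?_
      rw [← Complex.mul_conj', RCLike.star_def]
      ring
    have e2 : ∑ j, a j.1 * ‖star (M i j) * (((a j.1)⁻¹ : ℝ) : ℂ)‖ ^ 2 = S := by
      refine Finset.sum_congr rfl fun j _ => ?_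
      rw [norm_mul, norm_star, Complex.norm_real, mul_pow, Real.norm_eq_abs, sq_abs]
      rcases (ha j.1).eq_or_lt with h0 | h0
      · simp [← h0]
      · field_simp
    rw [e2] at h
    have h2 : p i * S ^ 2 ≤ K * S := by
      refine le_trans ?_ h
      have := Finset.single_le_sum (f := fun k => p k * ‖∑ j, M k j * (star (M i j) *
        ((a j.1)⁻¹ : ℝ))‖ ^ 2) (fun k _ => mul_nonneg (hp k) (sq_nonneg _)) (Finset.mem_univ i)
      simp only [e1] at this
      rw [Complex.norm_real, Real.norm_eq_abs, sq_abs] at this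
      exact this
    rcases hS.eq_or_lt with h0 | h0
    · rw [← h0]; simpa using hK.le
    · exact le_of_mul_le_mul_right (by linarith [h2, sq S]) h0
  have s1 : ∑ i, ∑ j, p i * (p i * (‖M i j‖ ^ 2 * (a j.1)⁻¹)) * K⁻¹ ≤ 1 := by
    rw [← hp1]
    refine Finset.sum_le_sum fun i _ => ?_
    rw [← Finset.sum_mul, ← Finset.mul_sum, ← Finset.mul_sum, ← div_eq_mul_inv, div_le_iff₀ hK]
    exact mul_le_mul_of_nonneg_left (hrow i) (hp i)
  have s2 : ∑ i, ∑ j, p i * ‖M i j‖ ^ 2 * ((b j.2)⁻¹ * (Fintype.card B : ℝ)⁻¹) ≤ 1 := by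
    have : ∑ i, ∑ j : A × B, p i * ‖M i j‖ ^ 2 * ((b j.2)⁻¹ * (Fintype.card B : ℝ)⁻¹)
        = ∑ s, b s * ((b s)⁻¹ * (Fintype.card B : ℝ)⁻¹) := by
      simp_rw [Fintype.sum_prod_type_right]
      rw [Finset.sum_comm]
      refine Finset.sum_congr rfl fun s _ => ?_
      simp_rw [← Finset.sum_mul]
      rw [hb]
    rw [this]
    calc _ ≤ ∑ _s : B, (Fintype.card B : ℝ)⁻¹ := by
          refine Finset.sum_le_sum fun s _ => ?_
          rw [← mul_assoc]
          exact mul_le_of_le_one_left (by positivity) mul_inv_le_one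
      _ = 1 := by simp [hcard.ne']
  calc _ ≤ _ := Finset.sum_le_sum fun i _ => Finset.sum_le_sum fun j _ => hterm i j
    _ = (∑ i, ∑ j, p i * ‖M i j‖ ^ 2) * (Real.log (K * Fintype.card B) - 2)
        + ∑ i, ∑ j, p i * (p i * (‖M i j‖ ^ 2 * (a j.1)⁻¹)) * K⁻¹
        + ∑ i, ∑ j, p i * ‖M i j‖ ^ 2 * ((b j.2)⁻¹ * (Fintype.card B : ℝ)⁻¹) := by
      simp_rw [Finset.sum_add_distrib, ← Finset.sum_mul]
    _ ≤ _ := by rw [hsum]; linarith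

theorem star_dotProduct_self_eq {n : Type*} [Fintype n] (x : n → ℂ) :
    star x ⬝ᵥ x = ((∑ i, ‖x i‖ ^ 2 : ℝ) : ℂ) := by
  simp only [dotProduct, Pi.star_apply, RCLike.star_def, Complex.conj_mul']
  push_cast
  rfl

theorem posSemidef_opNorm_sq_sub {m n : Type*} [Fintype m] [Fintype n] [DecidableEq n]
    (T : Matrix m n ℂ) : (((opNorm T ^ 2 : ℝ) : ℂ) • (1 : Matrix n n ℂ) - Tᴴ * T).PosSemidef := by
  refine PosSemidef.of_dotProduct_mulVec_nonneg ?_ fun x => ?_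
  · refine IsHermitian.sub ?_ (isHermitian_conjTranspose_mul_self T)
    rw [IsHermitian, conjTranspose_smul, conjTranspose_one, RCLike.star_def, Complex.conj_ofReal]
  · have h := (LinearMap.toContinuousLinearMap (Matrix.toEuclideanLin T)).le_opNorm
      (WithLp.toLp 2 x)
    have h2 := pow_le_pow_left₀ (norm_nonneg _) h 2
    rw [mul_pow, EuclideanSpace.norm_sq_eq, EuclideanSpace.norm_sq_eq] at h2
    have h3 : ∑ i, ‖(T *ᵥ x) i‖ ^ 2 ≤ opNorm T ^ 2 * ∑ i, ‖x i‖ ^ 2 := h2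
    rw [sub_mulVec, smul_mulVec, one_mulVec, dotProduct_sub, dotProduct_smul, ← mulVec_mulVec,
      dotProduct_mulVec, ← star_mulVec, star_dotProduct_self_eq, star_dotProduct_self_eq,
      smul_eq_mul, ← Complex.ofReal_mul, ← Complex.ofReal_sub]
    exact Complex.zero_le_real.mpr (sub_nonneg.mpr h3)

open scoped Kronecker in
theorem relEnt_kronecker_le {A B : Type*} [Fintype A] [Fintype B] [DecidableEq A] [DecidableEq B]
    (ρ : Matrix (A × B) (A × B) ℂ) (α : Matrix A A ℂ) (β : Matrix B B ℂ) (K : ℝ)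
    (hρ : IsDensity ρ) (hα : α.PosSemidef) (hβ : β.IsHermitian)
    (hpartial : ∀ X : Matrix B B ℂ, (ρ * ((1 : Matrix A A ℂ) ⊗ₖ X)).trace = (β * X).trace)
    (hdom : ((K : ℂ) • (α ⊗ₖ (1 : Matrix B B ℂ)) - ρ).PosSemidef) :
    relEnt ρ (α ⊗ₖ β) ≤ Real.log (K * Fintype.card B) := by
  have hH := hρ.1.1
  set V : Matrix (A × B) (A × B) ℂ := (hH.eigenvectorUnitary : Matrix (A × B) (A × B) ℂ)
  set p := hH.eigenvalues
  set UA : Matrix A A ℂ := (hα.1.eigenvectorUnitary : Matrix A A ℂ)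
  set a := hα.1.eigenvalues
  set UB : Matrix B B ℂ := (hβ.eigenvectorUnitary : Matrix B B ℂ)
  set b := hβ.eigenvalues
  have hV : V * Vᴴ = 1 := Unitary.mul_star_self_of_mem hH.eigenvectorUnitary.2
  have hUA : UA * UAᴴ = 1 := Unitary.mul_star_self_of_mem hα.1.eigenvectorUnitary.2
  have hUB : UB * UBᴴ = 1 := Unitary.mul_star_self_of_mem hβ.eigenvectorUnitary.2
  have hV' : Vᴴ * V = 1 := mul_eq_one_comm.mp hV
  have hUA' : UAᴴ * UA = 1 := mul_eq_one_comm.mp hUA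
  have hUB' : UBᴴ * UB = 1 := mul_eq_one_comm.mp hUB
  have hsV : ρ = V * diagonal (fun k => (p k : ℂ)) * Vᴴ := hH.spectral_theorem
  have hsA : α = UA * diagonal (fun k => (a k : ℂ)) * UAᴴ := hα.1.spectral_theorem
  have hsB : β = UB * diagonal (fun k => (b k : ℂ)) * UBᴴ := hβ.spectral_theorem
  set U := UA ⊗ₖ UB with hUdef
  have hUc : Uᴴ = UAᴴ ⊗ₖ UBᴴ := conjTranspose_kronecker _ _
  have hU : U * Uᴴ = 1 := by
    rw [hUc, ← mul_kronecker_mul, hUA, hUB, one_kronecker_one]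
  have hU' : Uᴴ * U = 1 := mul_eq_one_comm.mp hU
  have hsU : α ⊗ₖ β = U * diagonal (fun k => ((a k.1 * b k.2 : ℝ) : ℂ)) * Uᴴ := by
    conv_lhs => rw [hsA, hsB]
    rw [mul_kronecker_mul, mul_kronecker_mul, diagonal_kronecker_diagonal, ← hUc]
    simp only [Complex.ofReal_mul, hUdef]
  set M := Vᴴ * U with hMdef
  clear_value M
  have hMM : M * Mᴴ = 1 := by
    rw [hMdef, conjTranspose_mul, conjTranspose_conjTranspose, Matrix.mul_assoc,
      ← Matrix.mul_assoc U, hU, Matrix.one_mul, hV']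
  have hrowM : ∀ i, ∑ j, ‖M i j‖ ^ 2 = 1 := by
    intro i
    have := congrFun (congrFun hMM i) i
    rw [Matrix.mul_apply, one_apply_eq] at this
    simp only [conjTranspose_apply, RCLike.star_def, Complex.mul_conj'] at this
    exact_mod_cast this
  have hUρU : Uᴴ * ρ * U = Mᴴ * diagonal (fun k => (p k : ℂ)) * M := by
    rw [hMdef, conjTranspose_mul, conjTranspose_conjTranspose]
    conv_lhs => rw [hsV]
    simp only [Matrix.mul_assoc]
  have hrel : relEnt ρ (α ⊗ₖ β) =
      ∑ i, ∑ j, p i * ‖M i j‖ ^ 2 * (Real.log (p i) - Real.log (a j.1 * b j.2)) := by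
    have h1 := trace_spectral_mul_spectral V V p (fun i => Real.log (p i))
    have h2 := trace_spectral_mul_spectral V U p (fun j => Real.log (a j.1 * b j.2))
    rw [← hsV] at h1 h2
    rw [relEnt, mlog_eq_of_spectral ρ V hV p hsV, mlog_eq_of_spectral _ U hU _ hsU, Matrix.mul_sub,
      trace_sub, h1, h2, ← Complex.ofReal_sub, Complex.ofReal_re, hV', ← hMdef]
    simp_rw [mul_sub, Finset.sum_sub_distrib, ← Finset.sum_mul, ← Finset.mul_sum]
    congr 1
    refine Finset.sum_congr rfl fun i _ => ?_
    rw [hrowM, Finset.sum_eq_single i]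
    · simp
    · intro j _ hj; simp [one_apply_ne hj.symm]
    · simp
  rw [hrel]
  refine sum_log_sub_log_le p a b M K hρ.1.eigenvalues_nonneg ?_ hα.eigenvalues_nonneg hrowM ?_ ?_
  · have := hH.trace_eq_sum_eigenvalues
    rw [hρ.2] at this
    simpa [p] using (congrArg Complex.re this).symm
  · intro s
    have h1 := hpartial (UB * diagonal (Pi.single s 1) * UBᴴ)
    have e1 : (1 : Matrix A A ℂ) ⊗ₖ (UB * diagonal (Pi.single s 1) * UBᴴ)
        = U * diagonal (fun k : A × B => (((Pi.single s 1 : B → ℝ) k.2 : ℝ) : ℂ)) * Uᴴ := by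
      have : (1 : Matrix A A ℂ) = UA * 1 * UAᴴ := by rw [Matrix.mul_one, hUA]
      rw [this, mul_kronecker_mul, mul_kronecker_mul, ← hUc, ← diagonal_one,
        diagonal_kronecker_diagonal]
      congr 3
      ext k
      rcases eq_or_ne k.2 s with h | h <;> simp [h]
    have e2 : β * (UB * diagonal (Pi.single s 1) * UBᴴ) = (UB * diagonal (fun k => (b k : ℂ)) * UBᴴ)
        * (UB * diagonal (fun k => (((Pi.single s 1 : B → ℝ) k : ℝ) : ℂ)) * UBᴴ) := by
      rw [← hsB]
      congr 4
      ext k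
      rcases eq_or_ne k s with h | h <;> simp [h]
    rw [e1, e2, trace_spectral_mul_spectral, hUB'] at h1
    conv_lhs at h1 => rw [hsV]
    rw [trace_spectral_mul_spectral, ← hMdef] at h1
    have h2 := Complex.ofReal_inj.mp h1
    have e3 : ∑ i, ∑ j, b i * ‖(1 : Matrix B B ℂ) i j‖ ^ 2 * (Pi.single s 1 : B → ℝ) j = b s := by
      simp [Pi.single_apply, one_apply, apply_ite]
    rw [e3] at h2
    rw [← h2]
    simp only [Fintype.sum_prod_type]
    simp [Pi.single_apply]
  · intro y
    have h1 := (hdom.conjTranspose_mul_mul_same U).dotProduct_mulVec_nonneg y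
    have e1 : Uᴴ * (α ⊗ₖ (1 : Matrix B B ℂ)) * U = diagonal fun k : A × B => (a k.1 : ℂ) := by
      have : UAᴴ * α * UA = diagonal fun k => (a k : ℂ) := by
        rw [hsA]
        simp only [Matrix.mul_assoc, hUA', Matrix.mul_one]
        rw [← Matrix.mul_assoc, hUA', Matrix.one_mul]
      rw [hUc, ← mul_kronecker_mul, ← mul_kronecker_mul, this, Matrix.mul_one, hUB',
        ← diagonal_one, diagonal_kronecker_diagonal]
      simp
    have e2 : star y ⬝ᵥ (diagonal fun k : A × B => (a k.1 : ℂ)) *ᵥ y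
        = ((∑ j, a j.1 * ‖y j‖ ^ 2 : ℝ) : ℂ) := by
      simp only [dotProduct, mulVec_diagonal, Pi.star_apply, RCLike.star_def]
      push_cast
      refine Finset.sum_congr rfl fun j _ => ?_
      rw [← Complex.conj_mul']
      ring
    have e3 : star y ⬝ᵥ (Mᴴ * diagonal (fun k => (p k : ℂ)) * M) *ᵥ y
        = ((∑ i, p i * ‖∑ j, M i j * y j‖ ^ 2 : ℝ) : ℂ) := by
      rw [Matrix.mul_assoc, ← mulVec_mulVec, dotProduct_mulVec, ← star_mulVec, ← mulVec_mulVec]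
      simp only [dotProduct, mulVec_diagonal, Pi.star_apply, RCLike.star_def]
      push_cast
      refine Finset.sum_congr rfl fun j _ => ?_
      rw [← Complex.conj_mul']
      simp only [mulVec, dotProduct]
      ring
    rw [Matrix.mul_sub, Matrix.sub_mul, hUρU, Matrix.mul_smul, Matrix.smul_mul, e1, sub_mulVec,
      smul_mulVec, dotProduct_sub, dotProduct_smul, e2, e3, smul_eq_mul, ← Complex.ofReal_mul,
      ← Complex.ofReal_sub] at h1
    exact sub_nonneg.mp (Complex.zero_le_real.mp h1)

theorem mul_mul_eq_self_of_range_le_span {ι X R : Type*} [Fintype ι] [DecidableEq ι] [Fintype X]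
    [DecidableEq X] [Fintype R] {Φ : Matrix X R ℂ} {ρ : Matrix X X ℂ} (v : ι → X → ℂ)
    (hQQ : (Matrix.of fun x i => v i x)ᴴ * (Matrix.of fun x i => v i x) = 1)
    (hρ : ρ = Φ * Φᴴ) (hsupp : SuppIn ρ v) :
    (Matrix.of fun x i => v i x) * (Matrix.of fun x i => v i x)ᴴ * Φ = Φ := by
  set Q : Matrix X ι ℂ := Matrix.of fun x i => v i x with hQ
  have hspan : ∀ u ∈ Submodule.span ℂ (Set.range v), (Q * Qᴴ) *ᵥ u = u := by
    intro u hu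
    induction hu using Submodule.span_induction with
    | mem u hu =>
      obtain ⟨i, rfl⟩ := hu
      have : v i = Q *ᵥ Pi.single i 1 := by
        rw [mulVec_single_one]
        rfl
      rw [this, mulVec_mulVec, Matrix.mul_assoc, hQQ, Matrix.mul_one]
    | zero => rw [mulVec_zero]
    | add a b _ _ ha hb => rw [mulVec_add, ha, hb]
    | smul c a _ ha => rw [mulVec_smul, ha]
  have hPρ : (Q * Qᴴ - 1) * (Φ * Φᴴ) = 0 := by
    rw [← hρ, Matrix.sub_mul, Matrix.one_mul, sub_eq_zero]
    refine ext_of_mulVec_single fun x => ?_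
    rw [← mulVec_mulVec]
    exact hspan _ (hsupp ⟨_, rfl⟩)
  rw [mul_self_mul_conjTranspose_eq_zero, Matrix.sub_mul, Matrix.one_mul, sub_eq_zero] at hPρ
  exact hPρ

open scoped Kronecker

/-- relative-entropy bound `D(ρ^{RP1} ‖ ρ^R ⊗ ρ^{P1}) ≤ 2 log ‖t⁽¹⁾‖∞` for any
purification `φ` of a density matrix supported in the code space of the tensor `t`. -/
theorem stmt7 (d r : ℕ) (hd : 1 ≤ d) (hr : 1 ≤ r)
    (t : Fin r → Fin d → Fin d → Fin d → ℂ)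
    (v : Fin r → (Fin d × Fin d × Fin d) → ℂ)
    (hv : ∀ i x, v i x = (Real.sqrt d : ℂ)⁻¹ * t i x.1 x.2.1 x.2.2)
    (hon : ONFam v)
    (ρ : Matrix (Fin d × Fin d × Fin d) (Fin d × Fin d × Fin d) ℂ)
    (hρ : IsDensity ρ) (hsupp : SuppIn ρ v)
    (R : Type*) [Fintype R] [DecidableEq R]
    (φ : R × (Fin d × Fin d × Fin d) → ℂ)
    (hpure : (Matrix.of fun x y : Fin d × Fin d × Fin d =>
        ∑ w : R, φ (w, x) * star (φ (w, y))) = ρ)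
    (ρRP1 : Matrix (R × Fin d) (R × Fin d) ℂ)
    (hRP1 : ρRP1 = Matrix.of fun p q =>
        ∑ s2, ∑ s3, φ (p.1, (p.2, s2, s3)) * star (φ (q.1, (q.2, s2, s3))))
    (ρR : Matrix R R ℂ)
    (hR : ρR = Matrix.of fun w w' => ∑ x, φ (w, x) * star (φ (w', x)))
    (ρP1 : Matrix (Fin d) (Fin d) ℂ)
    (hP1 : ρP1 = Matrix.of fun s s' =>
        ∑ w : R, ∑ s2, ∑ s3, φ (w, (s, s2, s3)) * star (φ (w, (s', s2, s3)))) :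
    relEnt ρRP1 (Matrix.of fun p q : R × Fin d => ρR p.1 q.1 * ρP1 p.2 q.2) ≤
      2 * Real.log (opNorm (Matrix.of fun (p : Fin d × Fin d) (q : Fin r × Fin d) => t q.1 q.2 p.1 p.2)) := by
  set T : Matrix (Fin d × Fin d) (Fin r × Fin d) ℂ := Matrix.of fun p q => t q.1 q.2 p.1 p.2 with hT
  set Q : Matrix (Fin d × Fin d × Fin d) (Fin r) ℂ := Matrix.of fun x i => v i x with hQ
  set Φ : Matrix (Fin d × Fin d × Fin d) R ℂ := Matrix.of fun x w => φ (w, x) with hΦ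
  have hQQ : Qᴴ * Q = 1 := by
    ext i j
    rw [Matrix.mul_apply, one_apply]
    exact hon i j
  have hρΦ : ρ = Φ * Φᴴ := by
    rw [← hpure]
    ext x y
    simp [Matrix.mul_apply, hΦ]
  set D := Qᴴ * Φ with hD
  have hΦD : Φ = Q * D := by
    rw [hD, ← Matrix.mul_assoc]
    exact (mul_mul_eq_self_of_range_le_span v hQQ hρΦ hsupp).symm
  have hφ : ∀ w x, φ (w, x) = ∑ i, v i x * D i w := fun w x => congrFun (congrFun hΦD x) w
  clear_value D
  have hRD : ρR = Dᵀ * Dᵀᴴ := by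
    have e1 : ρR = Φᵀ * Φᵀᴴ := by
      rw [hR]
      ext w w'
      simp [Matrix.mul_apply, hΦ]
    have e2 : Qᵀ * Qᵀᴴ = 1 := by
      have := congrArg transpose hQQ
      rwa [transpose_mul, transpose_one] at this
    rw [e1, hΦD, transpose_mul, conjTranspose_mul, Matrix.mul_assoc, ← Matrix.mul_assoc Qᵀ, e2,
      Matrix.one_mul]
  set G : Matrix (R × Fin d) (Fin r × Fin d) ℂ := Dᵀ ⊗ₖ (1 : Matrix (Fin d) (Fin d) ℂ) with hG
  set F : Matrix (R × Fin d) (Fin d × Fin d) ℂ := Matrix.of fun p q => φ (p.1, (p.2, q.1, q.2))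
    with hF
  have hρF : ρRP1 = F * Fᴴ := by
    rw [hRP1]
    ext p q
    simp [Matrix.mul_apply, hF, Fintype.sum_prod_type]
  have hFG : F = (Real.sqrt d : ℂ)⁻¹ • (G * Tᵀ) := by
    ext ⟨w, s⟩ ⟨s2, s3⟩
    simp only [hF, of_apply, hφ, hv, Matrix.smul_apply, Matrix.mul_apply, hG, kroneckerMap_apply, hT,
      transpose_apply, Fintype.sum_prod_type, smul_eq_mul, one_apply, Finset.mul_sum]
    refine Finset.sum_congr rfl fun i _ => ?_
    rw [Finset.sum_eq_single s]
    · simp only [if_true]; ring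
    · intro b _ hb; simp [hb.symm]
    · simp
  have hd0 : (0 : ℝ) < d := by exact_mod_cast hd
  have hsq : (Real.sqrt d : ℂ)⁻¹ * star (Real.sqrt d : ℂ)⁻¹ = ((d : ℝ)⁻¹ : ℝ) := by
    rw [RCLike.star_def, ← Complex.ofReal_inv, Complex.conj_ofReal, ← Complex.ofReal_mul,
      ← mul_inv, Real.mul_self_sqrt hd0.le]
  have hcard : opNorm T ^ 2 / d * Fintype.card (Fin d) = opNorm T ^ 2 := by
    rw [Fintype.card_fin]
    field_simp
  have hmain := relEnt_kronecker_le ρRP1 ρR ρP1 (opNorm T ^ 2 / d) ?_ ?_ ?_ ?_ ?_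
  · rw [hcard, Real.log_pow] at hmain
    exact_mod_cast hmain
  · refine ⟨hρF ▸ posSemidef_self_mul_conjTranspose F, ?_⟩
    rw [← hρ.2, ← hpure, hRP1]
    simp only [trace, diag, of_apply, Fintype.sum_prod_type]
    rw [Finset.sum_comm]
    refine Finset.sum_congr rfl fun s _ => ?_
    rw [Finset.sum_comm]
    exact Finset.sum_congr rfl fun s2 _ => Finset.sum_comm
  · exact hRD ▸ posSemidef_self_mul_conjTranspose _
  · ext s s'
    simp [hP1, mul_comm]
  · intro X
    have hP : ∀ s s', ρP1 s s' = ∑ w, ρRP1 (w, s) (w, s') := by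
      intro s s'
      simp [hP1, hRP1]
    simp only [trace, diag, Matrix.mul_apply, kroneckerMap_apply, Fintype.sum_prod_type, hP,
      Finset.sum_mul]
    rw [Finset.sum_comm]
    refine Finset.sum_congr rfl fun s _ => ?_
    conv_rhs => rw [Finset.sum_comm]
    refine Finset.sum_congr rfl fun w _ => ?_
    rw [Finset.sum_eq_single w]
    · simp
    · intro w' _ hw'; simp [one_apply_ne hw']
    · simp
  · have e1 : ((opNorm T ^ 2 / d : ℝ) : ℂ) • (ρR ⊗ₖ (1 : Matrix (Fin d) (Fin d) ℂ)) - ρRP1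
        = G * ((((d : ℝ)⁻¹ : ℝ) : ℂ) • (((opNorm T ^ 2 : ℝ) : ℂ) • 1 - Tᴴ * T)ᵀ) * Gᴴ := by
      have e2 : ρR ⊗ₖ (1 : Matrix (Fin d) (Fin d) ℂ) = G * Gᴴ := by
        rw [hG, conjTranspose_kronecker, ← mul_kronecker_mul, hRD, conjTranspose_one,
          Matrix.mul_one]
      have e3 : ρRP1 = (((d : ℝ)⁻¹ : ℝ) : ℂ) • (G * (Tᵀ * Tᵀᴴ) * Gᴴ) := by
        rw [hρF, hFG, conjTranspose_smul, Matrix.smul_mul, Matrix.mul_smul, smul_smul, hsq,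
          conjTranspose_mul]
        simp only [Matrix.mul_assoc]
      have e4 : (Tᴴ * T)ᵀ = Tᵀ * Tᵀᴴ := transpose_mul _ _
      rw [e2, e3, transpose_sub, e4, transpose_smul, transpose_one, smul_sub, Matrix.mul_sub,
        Matrix.sub_mul, smul_smul, Matrix.mul_smul, Matrix.smul_mul, Matrix.mul_smul,
        Matrix.smul_mul, Matrix.mul_one, ← Complex.ofReal_mul, div_eq_inv_mul]
    rw [e1]
    refine PosSemidef.mul_mul_conjTranspose_same (PosSemidef.smul ?_ ?_) G
    · exact (posSemidef_opNorm_sq_sub T).transpose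
    · exact Complex.zero_le_real.mpr (inv_nonneg.mpr hd0.le)
end
end
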